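/- arXiv:1611.03023 — 5 statements merged into one kernel-verified Lean document; each statement's English description precedes it below -/
import Mathlib

section
/- Under assumptions (A1)–(A3), the solution of the stochastic fixed-point equation is unique up to P-null sets: if η : Ω → V is any (not necessarily measurable) mapping with η(ω) ∈ X(ω) for all ω and η(Tω) = f(ω, η(ω)) for P-almost all ω, then η coincides P-almost surely with the ℱ₀-measurable solution ξ (with ξ(ω) ∈ Y(ω)) whose existence is guaranteed by the theorem; in particular any two such solutions coincide almost surely. -/
open MeasureTheory Filter Topology
open scoped ENNReal Classical

noncomputable section

/-- The backward composition `f^{(m)}(ω, ·) = f₀(ω) ∘ f₋₁(ω) ∘ … ∘ f₋ₘ(ω)`, where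
`f_k(ω, x) = f(T^{k-1} ω, x)` and `S = T⁻¹`; thus
`backComp S f m ω x = f(T⁻¹ω)(f(T⁻²ω)(… f(T^{-m-1}ω) x …))`. -/
def backComp {Ω V : Type*} (S : Ω → Ω) (f : Ω → V → V) : ℕ → Ω → V → V
  | 0 => fun ω x => f (S ω) x
  | m + 1 => fun ω x => backComp S f m ω (f (S^[m + 2] ω) x)

section MeasurableProjection

/-- A continuous image of Baire space contains compact sets of almost full measure. -/
theorem exists_isCompact_subset_range_measure_le {Z : Type*} [TopologicalSpace Z]
    [TopologicalSpace.MetrizableSpace Z] [MeasurableSpace Z] [BorelSpace Z] (μ : Measure Z)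
    [IsFiniteMeasure μ] {g : (ℕ → ℕ) → Z} (hg : Continuous g) {ε : ℝ≥0∞} (hε : ε ≠ 0) :
    ∃ C ⊆ Set.range g, IsCompact C ∧ μ (Set.range g) ≤ μ C + ε := by
  let := TopologicalSpace.metrizableSpaceMetric Z
  rcases eq_or_ne (μ (Set.range g)) 0 with h0 | h0
  · exact ⟨∅, Set.empty_subset _, isCompact_empty, by simp [h0]⟩
  set t := μ (Set.range g) - ε with ht
  have htlt : t < μ (Set.range g) := ENNReal.sub_lt_self (measure_ne_top _ _) h0 hε
  have hstep : ∀ (D : Set (ℕ → ℕ)) (n : ℕ), t < μ (g '' D) →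
      ∃ k, t < μ (g '' (D ∩ {x | x n ≤ k})) := by
    intro D n hD
    have hmono : Monotone fun k => g '' (D ∩ {x | x n ≤ k}) := fun k l hkl =>
      Set.image_mono fun x hx => ⟨hx.1, le_trans hx.2 hkl⟩
    have hU : ⋃ k, g '' (D ∩ {x | x n ≤ k}) = g '' D := by
      rw [← Set.image_iUnion]
      congr 1
      ext x
      simp only [Set.mem_iUnion, Set.mem_inter_iff, Set.mem_ofPred_eq]
      exact ⟨fun ⟨_, h, _⟩ => h, fun h => ⟨x n, h, le_rfl⟩⟩
    rw [← hU, hmono.measure_iUnion] at hD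
    exact lt_iSup_iff.1 hD
  choose! c hc using hstep
  let D : ℕ → Set (ℕ → ℕ) := fun n =>
    Nat.rec Set.univ (fun n D => D ∩ {x | x n ≤ c D n}) n
  have hD : ∀ n, t < μ (g '' D n) := by
    intro n
    induction n with
    | zero => simpa [D] using htlt
    | succ n ih => exact hc _ n ih
  let b : ℕ → ℕ := fun n => c (D n) n
  have hDmem : ∀ n x, x ∈ D n → ∀ i < n, x i ≤ b i := by
    intro n
    induction n with
    | zero => simp
    | succ n ih =>
      intro x hx i hi
      rcases Nat.lt_succ_iff_lt_or_eq.1 hi with h | rfl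
      · exact ih x hx.1 i h
      · exact hx.2
  have hDanti : Antitone D := antitone_nat_of_succ_le fun n => Set.inter_subset_left
  let K : Set (ℕ → ℕ) := Set.pi Set.univ fun i => Set.Iic (b i)
  have hK : IsCompact K := isCompact_univ_pi fun i => (Set.finite_Iic (b i)).isCompact
  refine ⟨g '' K, Set.image_subset_range _ _, hK.image hg, ?_⟩
  have hsub : ⋂ n, closure (g '' D n) ⊆ g '' K := by
    intro z hz
    have hy : ∀ n : ℕ, ∃ y ∈ D n, dist z (g y) < 1 / ((n : ℝ) + 1) := by
      intro n
      obtain ⟨_, ⟨y, hy, rfl⟩, hd⟩ :=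
        Metric.mem_closure_iff.1 (Set.mem_iInter.1 hz n) _ (Nat.one_div_pos_of_nat (α := ℝ))
      exact ⟨y, hy, hd⟩
    choose y hyD hyd using hy
    obtain ⟨x, hxK, σ, hσ, hlim⟩ := hK.tendsto_subseq
      (x := fun n i => min (y n i) (b i)) (fun n i _ => Set.mem_Iic.2 (min_le_right _ _))
    have hylim : Tendsto (y ∘ σ) atTop (𝓝 x) := by
      rw [tendsto_pi_nhds] at hlim ⊢
      intro i
      refine (hlim i).congr' ?_
      filter_upwards [eventually_gt_atTop i] with n hn
      exact min_eq_left (hDmem _ _ (hyD _) i (hn.trans_le (hσ.id_le n)))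
    have h1 : Tendsto (fun n => g (y (σ n))) atTop (𝓝 (g x)) := (hg.tendsto x).comp hylim
    have h2 : Tendsto (fun n => g (y n)) atTop (𝓝 z) := by
      rw [tendsto_iff_dist_tendsto_zero]
      refine squeeze_zero (fun _ => dist_nonneg) (fun n => ?_)
        (tendsto_one_div_add_atTop_nhds_zero_nat (𝕜 := ℝ))
      rw [dist_comm]
      exact (hyd n).le
    exact ⟨x, hxK, tendsto_nhds_unique h1 (h2.comp hσ.tendsto_atTop)⟩
  have hle : t ≤ μ (⋂ n, closure (g '' D n)) := by
    refine ge_of_tendsto (tendsto_measure_iInter_atTop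
      (fun n => isClosed_closure.measurableSet.nullMeasurableSet)
      (fun m n hmn => closure_mono (Set.image_mono (hDanti hmn)))
      ⟨0, measure_ne_top _ _⟩) (Eventually.of_forall fun n => ?_)
    exact (hD n).le.trans (measure_mono subset_closure)
  exact tsub_le_iff_right.1 (hle.trans (measure_mono hsub))

/-- Analytic sets are universally measurable. -/
theorem MeasureTheory.AnalyticSet.nullMeasurableSet_of_isFiniteMeasure {Z : Type*}
    [TopologicalSpace Z] [TopologicalSpace.MetrizableSpace Z] [MeasurableSpace Z] [BorelSpace Z]
    {s : Set Z} (hs : AnalyticSet s) (μ : Measure Z) [IsFiniteMeasure μ] :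
    NullMeasurableSet s μ := by
  rw [AnalyticSet] at hs
  rcases hs with rfl | ⟨g, hg, rfl⟩
  · exact MeasurableSet.empty.nullMeasurableSet
  have h : ∀ n : ℕ, ∃ C ⊆ Set.range g, IsCompact C ∧
      μ (Set.range g) ≤ μ C + ((n : ℝ≥0∞) + 1)⁻¹ := fun n =>
    exists_isCompact_subset_range_measure_le μ hg
      (ENNReal.inv_ne_zero.2 (by finiteness))
  choose C hCs hC hCμ using h
  have hm : MeasurableSet (⋃ n, C n) := .iUnion fun n => (hC n).measurableSet
  have hlim : Tendsto (fun n : ℕ => μ (⋃ n, C n) + ((n : ℝ≥0∞) + 1)⁻¹) atTop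
      (𝓝 (μ (⋃ n, C n) + 0)) := by
    refine tendsto_const_nhds.add ?_
    have := (tendsto_add_atTop_iff_nat 1).2 ENNReal.tendsto_inv_nat_nhds_zero
    simpa using this
  refine hm.nullMeasurableSet.congr (ae_eq_of_subset_of_measure_ge (Set.iUnion_subset hCs) ?_
    hm.nullMeasurableSet (measure_ne_top _ _))
  rw [add_zero] at hlim
  exact ge_of_tendsto' hlim fun n => (hCμ n).trans (by gcongr; exact Set.subset_iUnion C n)

/-- A measurable subset of a product depends on the first coordinate through countably many
measurable events. -/
theorem MeasurableSet.exists_eq_preimage_prodMap {Ω V : Type*} [MeasurableSpace Ω]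
    [MeasurableSpace V] {E : Set (Ω × V)} (hE : MeasurableSet E) :
    ∃ φ : Ω → ℕ → Bool, Measurable φ ∧ ∃ G : Set ((ℕ → Bool) × V), MeasurableSet G ∧
      E = Prod.map φ id ⁻¹' G := by
  rw [← generateFrom_prod] at hE
  induction E, hE using MeasurableSpace.generateFrom_induction with
  | hC t ht _ =>
    obtain ⟨A, hA, B, hB, rfl⟩ := ht
    refine ⟨fun ω _ => decide (ω ∈ A), measurable_pi_lambda _ fun _ =>
      measurable_to_bool (by simpa [Set.preimage] using hA),
      {p | p.1 0 = true} ∩ Prod.snd ⁻¹' B, ?_, ?_⟩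
    · refine MeasurableSet.inter ?_ (measurable_snd hB)
      exact measurableSet_eq_fun (by fun_prop) measurable_const
    · ext ⟨ω, v⟩
      simp
  | empty => exact ⟨fun _ _ => true, measurable_const, ∅, .empty, by simp⟩
  | compl t _ ih =>
    obtain ⟨φ, hφ, G, hG, rfl⟩ := ih
    exact ⟨φ, hφ, Gᶜ, hG.compl, rfl⟩
  | iUnion s _ ih =>
    choose φ hφ G hG hs using ih
    refine ⟨fun ω k => φ k.unpair.1 ω k.unpair.2, by fun_prop,
      ⋃ n, (fun p : (ℕ → Bool) × V => (fun j => p.1 (Nat.pair n j), p.2)) ⁻¹' G n,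
      .iUnion fun n => ?_, ?_⟩
    · exact (by fun_prop : Measurable fun p : (ℕ → Bool) × V =>
        ((fun j => p.1 (Nat.pair n j) : ℕ → Bool), p.2)) (hG n)
    · rw [Set.preimage_iUnion]
      refine Set.iUnion_congr fun n => ?_
      rw [hs n]
      ext ⟨ω, v⟩
      simp

/-- The measurable projection theorem. -/
theorem MeasurableSet.image_fst_of_isComplete {Ω V : Type*} [MeasurableSpace Ω]
    [MeasurableSpace V] [StandardBorelSpace V] (P : Measure Ω) [IsFiniteMeasure P]
    [P.IsComplete] {E : Set (Ω × V)} (hE : MeasurableSet E) :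
    MeasurableSet (Prod.fst '' E) := by
  obtain ⟨φ, hφ, G, hG, rfl⟩ := hE.exists_eq_preimage_prodMap
  have hA : NullMeasurableSet (Prod.fst '' G) (P.map φ) :=
    (hG.analyticSet_image measurable_fst).nullMeasurableSet_of_isFiniteMeasure _
  have himage : Prod.fst '' (Prod.map φ id ⁻¹' G) = φ ⁻¹' (Prod.fst '' G) := by
    ext ω
    simp
  rw [himage]
  exact (hA.preimage (hφ.quasiMeasurePreserving P)).measurable_of_complete

end MeasurableProjection

section Recurrence

/-- A function that eventually strictly exceeds its present positive value along almost every
orbit of a conservative map vanishes almost everywhere. -/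
theorem MeasureTheory.Conservative.ae_eq_zero_of_eventually_lt {Ω : Type*} [MeasurableSpace Ω]
    {μ : Measure Ω} {S : Ω → Ω} (hS : Conservative S μ) {D : Ω → ℝ≥0∞} (hD : Measurable D)
    (h : ∀ᵐ ω ∂μ, 0 < D ω → ∀ᶠ n in atTop, D ω < D (S^[n] ω)) : ∀ᵐ ω ∂μ, D ω = 0 := by
  have horbit : ∀ᵐ ω ∂μ, ∀ k : ℕ,
      0 < D (S^[k] ω) → ∀ᶠ n in atTop, D (S^[k] ω) < D (S^[n] (S^[k] ω)) :=
    ae_all_iff.2 fun k => (hS.toQuasiMeasurePreserving.iterate k).ae h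
  have hrec : ∀ᵐ ω ∂μ, ∀ q : ℚ, D ω ≤ (Real.toNNReal q : ℝ≥0∞) →
      ∃ᶠ n in atTop, D (S^[n] ω) ≤ (Real.toNNReal q : ℝ≥0∞) :=
    ae_all_iff.2 fun q => hS.ae_mem_imp_frequently_image_mem
      (s := {ω | D ω ≤ (Real.toNNReal q : ℝ≥0∞)})
      (measurableSet_le hD measurable_const).nullMeasurableSet
  filter_upwards [horbit, hrec] with ω ho hr
  by_contra hne
  have hpos : 0 < D ω := pos_iff_ne_zero.2 hne
  obtain ⟨k, hk⟩ := (ho 0 hpos).exists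
  obtain ⟨q, -, hq1, hq2⟩ := ENNReal.lt_iff_exists_rat_btwn.1 hk
  have hev := ho k (hpos.trans hk)
  have hev' : ∀ᶠ n in atTop, D (S^[k] ω) < D (S^[n] ω) := by
    rw [← map_add_atTop_eq_nat k, eventually_map]
    filter_upwards [hev] with n hn
    rwa [Function.iterate_add_apply]
  obtain ⟨n, hn1, hn2⟩ := ((hr q hq1.le).and_eventually hev').exists
  exact absurd (hn2.trans_le hn1) hq2.not_gt

end Recurrence

section MetricOn

variable {V : Type*}

/-- `d` restricts to a metric on the set `Y`. -/
structure IsMetricOn (Y : Set V) (d : V → V → ℝ) : Prop where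
  nonneg : ∀ x ∈ Y, ∀ y ∈ Y, 0 ≤ d x y
  eq_zero_iff : ∀ x ∈ Y, ∀ y ∈ Y, d x y = 0 ↔ x = y
  comm : ∀ x ∈ Y, ∀ y ∈ Y, d x y = d y x
  triangle : ∀ x ∈ Y, ∀ y ∈ Y, ∀ z ∈ Y, d x z ≤ d x y + d y z

/-- The metric space structure on the subtype `Y`. -/
abbrev IsMetricOn.metricSpace {Y : Set V} {d : V → V → ℝ} (h : IsMetricOn Y d) :
    MetricSpace Y where
  dist x y := d x y
  dist_self x := (h.eq_zero_iff x x.2 x x.2).2 rfl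
  dist_comm x y := h.comm x x.2 y y.2
  dist_triangle x y z := h.triangle x x.2 y y.2 z z.2
  eq_of_dist_eq_zero {x y} hxy := Subtype.ext ((h.eq_zero_iff x x.2 y y.2).1 hxy)

/-- Sequential compactness of `K` with respect to the distance function `d`. -/
def SeqCompactFor (d : V → V → ℝ) (K : Set V) : Prop :=
  ∀ u : ℕ → V, (∀ k, u k ∈ K) →
    ∃ z ∈ K, ∃ σ : ℕ → ℕ, StrictMono σ ∧ Tendsto (fun k => d z (u (σ k))) atTop (𝓝 0)

theorem IsMetricOn.isCompact_preimage {Y : Set V} {d : V → V → ℝ} (h : IsMetricOn Y d)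
    {K : Set V} (hKY : K ⊆ Y) (hK : SeqCompactFor d K) :
    letI := h.metricSpace
    IsCompact ((↑) ⁻¹' K : Set Y) := by
  let := h.metricSpace
  refine IsSeqCompact.isCompact fun u hu => ?_
  obtain ⟨z, hz, σ, hσ, hlim⟩ := hK (fun k => u k) hu
  refine ⟨⟨z, hKY hz⟩, hz, σ, hσ, tendsto_iff_dist_tendsto_zero.2 ?_⟩
  refine hlim.congr fun k => ?_
  exact h.comm z (hKY hz) _ (u (σ k)).2

/-- The intersection of a decreasing sequence of nonempty, eventually compact sets is nonempty
and its diameter is attained. -/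
theorem IsMetricOn.exists_max_iInter {Y : Set V} {d : V → V → ℝ} (h : IsMetricOn Y d)
    {K : ℕ → Set V} (hanti : Antitone K) (hne : ∀ n, (K n).Nonempty)
    (hK : ∃ M, ∀ n, M ≤ n → K n ⊆ Y ∧ SeqCompactFor d (K n)) :
    ∃ x ∈ ⋂ n, K n, ∃ y ∈ ⋂ n, K n, ∀ x' ∈ ⋂ n, K n, ∀ y' ∈ ⋂ n, K n, d x' y' ≤ d x y := by
  let := h.metricSpace
  obtain ⟨M, hM⟩ := hK
  let L : ℕ → Set Y := fun n => (↑) ⁻¹' K (n + M)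
  have hL : ∀ n, IsCompact (L n) := fun n =>
    h.isCompact_preimage (hM _ (Nat.le_add_left _ _)).1 (hM _ (Nat.le_add_left _ _)).2
  have hmem : ∀ x : Y, x ∈ ⋂ n, L n ↔ (x : V) ∈ ⋂ n, K n := by
    intro x
    simp only [Set.mem_iInter]
    exact ⟨fun hx n => hanti (Nat.le_add_right n M) (hx n), fun hx n => hx (n + M)⟩
  have hsub : ⋂ n, K n ⊆ Y := (Set.iInter_subset K M).trans (hM M le_rfl).1
  have hLne : (⋂ n, L n).Nonempty := by
    refine IsCompact.nonempty_iInter_of_sequence_nonempty_isCompact_isClosed L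
      (fun n => Set.preimage_mono (hanti (by lia))) (fun n => ?_) (hL 0)
      fun n => (hL n).isClosed
    obtain ⟨x, hx⟩ := hne (n + M)
    exact ⟨⟨x, (hM _ (Nat.le_add_left _ _)).1 hx⟩, hx⟩
  have hLc : IsCompact (⋂ n, L n) :=
    (hL 0).of_isClosed_subset (isClosed_iInter fun n => (hL n).isClosed) (Set.iInter_subset L 0)
  obtain ⟨⟨x, y⟩, ⟨hx, hy⟩, hmax⟩ := (hLc.prod hLc).exists_isMaxOn (hLne.prod hLne)
    (continuous_dist (α := Y)).continuousOn
  refine ⟨x, (hmem x).1 hx, y, (hmem y).1 hy, fun x' hx' y' hy' => ?_⟩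
  exact hmax (a := (⟨x', hsub hx'⟩, ⟨y', hsub hy'⟩)) ⟨(hmem _).2 hx', (hmem _).2 hy'⟩

/-- The fibre of a continuous map over a point is sequentially compact in a sequentially compact
set. -/
theorem SeqCompactFor.inter_preimage_singleton {Y Y' : Set V} {d d' : V → V → ℝ}
    (h' : IsMetricOn Y' d') {f : V → V} (hf : ∀ x ∈ Y, f x ∈ Y')
    (hcont : ∀ x ∈ Y, ∀ ε : ℝ, 0 < ε → ∃ δ : ℝ, 0 < δ ∧
      ∀ y ∈ Y, d x y < δ → d' (f x) (f y) < ε)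
    {K : Set V} (hKY : K ⊆ Y) (hK : SeqCompactFor d K) (x : V) :
    SeqCompactFor d (K ∩ f ⁻¹' {x}) := by
  intro u hu
  obtain ⟨z, hz, σ, hσ, hlim⟩ := hK u fun k => (hu k).1
  refine ⟨z, ⟨hz, ?_⟩, σ, hσ, hlim⟩
  have hx : x ∈ Y' := (hu 0).2 ▸ hf _ (hKY (hu 0).1)
  have hfz := hf z (hKY hz)
  refine (h'.eq_zero_iff _ hfz _ hx).1 (le_antisymm ?_ (h'.nonneg _ hfz _ hx))
  refine le_of_forall_pos_le_add fun ε hε => ?_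
  obtain ⟨δ, hδ, hδε⟩ := hcont z (hKY hz) ε hε
  obtain ⟨k, hk⟩ := (hlim.eventually_lt_const hδ).exists
  have := hδε _ (hKY (hu (σ k)).1) hk
  rw [(hu (σ k)).2] at this
  linarith

/-- The diameter of `A` for the extension of `d` by `∞` off `Y × Y`. -/
def extDiam (Y : Set V) (d : V → V → ℝ) (A : Set V) : ℝ≥0∞ :=
  ⨆ x ∈ A, ⨆ y ∈ A, if x ∈ Y ∧ y ∈ Y then ENNReal.ofReal (d x y) else ⊤

theorem lt_extDiam_iff {Y : Set V} {d : V → V → ℝ} {A : Set V} {c : ℝ≥0∞} :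
    c < extDiam Y d A ↔
      ∃ x ∈ A, ∃ y ∈ A, c < if x ∈ Y ∧ y ∈ Y then ENNReal.ofReal (d x y) else ⊤ := by
  simp only [extDiam, lt_iSup_iff, exists_prop]

theorem ofReal_le_extDiam {Y : Set V} {d : V → V → ℝ} {A : Set V} (hA : A ⊆ Y) {x y : V}
    (hx : x ∈ A) (hy : y ∈ A) : ENNReal.ofReal (d x y) ≤ extDiam Y d A := by
  refine le_trans ?_ (le_iSup₂_of_le x hx (le_iSup₂_of_le y hy le_rfl))
  rw [if_pos ⟨hA hx, hA hy⟩]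

theorem IsMetricOn.subsingleton_of_extDiam_eq_zero {Y : Set V} {d : V → V → ℝ}
    (h : IsMetricOn Y d) {A : Set V} (hA : A ⊆ Y) (h0 : extDiam Y d A = 0) :
    A.Subsingleton := fun x hx y hy =>
  (h.eq_zero_iff x (hA hx) y (hA hy)).1 <| le_antisymm
    (ENNReal.ofReal_eq_zero.1 (le_antisymm ((ofReal_le_extDiam hA hx hy).trans h0.le) bot_le))
    (h.nonneg x (hA hx) y (hA hy))

end MetricOn

section BackwardImages

variable {Ω V : Type*}

theorem backComp_succ_left (S : Ω → Ω) (f : Ω → V → V) (m : ℕ) (ω : Ω) (x : V) :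
    backComp S f (m + 1) ω x = f (S ω) (backComp S f m (S ω) x) := by
  induction m generalizing x with
  | zero => rfl
  | succ m ih => exact ih _

/-- The image `X^{(m)}(ω)` of `X` under the backward composition. -/
def backImage (S : Ω → Ω) (f : Ω → V → V) (X : Ω → Set V) (m : ℕ) (ω : Ω) : Set V :=
  backComp S f m ω '' X (S^[m + 1] ω)

/-- The intersection of all the sets `X^{(m)}(ω)`. -/
def pullbackLimit (S : Ω → Ω) (f : Ω → V → V) (X : Ω → Set V) (ω : Ω) : Set V :=
  ⋂ m, backImage S f X m ω

variable {S : Ω → Ω} {f : Ω → V → V} {X : Ω → Set V}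

theorem backImage_succ (m : ℕ) (ω : Ω) :
    backImage S f X (m + 1) ω = f (S ω) '' backImage S f X m (S ω) := by
  rw [backImage, backImage, Set.image_image, Function.iterate_succ_apply]
  exact Set.image_congr fun x _ => backComp_succ_left S f m ω x

theorem antitone_backImage (hf : ∀ ω, ∀ x ∈ X (S ω), f (S ω) x ∈ X ω) (ω : Ω) :
    Antitone fun m => backImage S f X m ω := by
  refine antitone_nat_of_succ_le fun m => ?_
  rintro _ ⟨x, hx, rfl⟩
  rw [Function.iterate_succ_apply'] at hx
  refine ⟨f (S^[m + 2] ω) x, ?_, rfl⟩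
  rw [Function.iterate_succ_apply' S (m + 1)]
  exact hf _ _ hx

theorem backComp_congr (hf : ∀ ω, ∀ x ∈ X (S ω), f (S ω) x ∈ X ω) {g : Ω → V → V}
    (hfg : ∀ ω, ∀ x ∈ X ω, g ω x = f ω x) (ω : Ω) (m : ℕ) :
    ∀ x ∈ X (S^[m + 1] ω), backComp S g m ω x = backComp S f m ω x := by
  induction m with
  | zero => exact fun x hx => hfg _ _ hx
  | succ m ih =>
    intro x hx
    simp only [backComp]
    rw [hfg _ _ hx]
    rw [Function.iterate_succ_apply'] at hx ⊢
    exact ih _ (hf _ _ hx)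

theorem pullbackLimit_congr (hf : ∀ ω, ∀ x ∈ X (S ω), f (S ω) x ∈ X ω) {g : Ω → V → V}
    (hfg : ∀ ω, ∀ x ∈ X ω, g ω x = f ω x) (ω : Ω) :
    pullbackLimit S g X ω = pullbackLimit S f X ω :=
  Set.iInter_congr fun m => Set.image_congr (backComp_congr hf hfg ω m)

theorem mem_pullbackLimit_of_orbit {η : Ω → V} (hηX : ∀ ω, η ω ∈ X ω) {ω : Ω}
    (hη : ∀ k, η (S^[k] ω) = f (S^[k + 1] ω) (η (S^[k + 1] ω))) :
    η ω ∈ pullbackLimit S f X ω := by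
  refine Set.mem_iInter.2 fun m => ⟨η (S^[m + 1] ω), hηX _, ?_⟩
  induction m with
  | zero => exact (hη 0).symm
  | succ m ih =>
    simp only [backComp]
    rw [← hη (m + 1), ih]

/-- The pullback limit is contained in the image of the previous pullback limit. -/
theorem pullbackLimit_subset_image {Y : Ω → Set V} {ρ : Ω → V → V → ℝ} {ω : Ω}
    (hρ : IsMetricOn (Y ω) (ρ ω)) (hρ' : IsMetricOn (Y (S ω)) (ρ (S ω)))
    (hfX : ∀ ω, ∀ x ∈ X (S ω), f (S ω) x ∈ X ω) (hfY : ∀ x ∈ Y (S ω), f (S ω) x ∈ Y ω)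
    (hcont : ∀ x ∈ Y (S ω), ∀ ε : ℝ, 0 < ε → ∃ δ : ℝ, 0 < δ ∧
      ∀ y ∈ Y (S ω), ρ (S ω) x y < δ → ρ ω (f (S ω) x) (f (S ω) y) < ε)
    (hK : ∃ M, ∀ m, M ≤ m → backImage S f X m (S ω) ⊆ Y (S ω) ∧
      SeqCompactFor (ρ (S ω)) (backImage S f X m (S ω))) :
    pullbackLimit S f X ω ⊆ f (S ω) '' pullbackLimit S f X (S ω) := by
  intro x hx
  have hne : ∀ m, (backImage S f X m (S ω) ∩ f (S ω) ⁻¹' {x}).Nonempty := by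
    intro m
    have := Set.mem_iInter.1 hx (m + 1)
    rw [backImage_succ] at this
    obtain ⟨u, hu, hux⟩ := this
    exact ⟨u, hu, hux⟩
  obtain ⟨M, hM⟩ := hK
  obtain ⟨u, hu, -⟩ := hρ'.exists_max_iInter
    (fun m n hmn => Set.inter_subset_inter_left _ (antitone_backImage hfX (S ω) hmn)) hne
    ⟨M, fun m hm => ⟨Set.inter_subset_left.trans (hM m hm).1,
      (hM m hm).2.inter_preimage_singleton hρ hfY hcont (hM m hm).1 x⟩⟩
  exact ⟨u, Set.mem_iInter.2 fun m => (Set.mem_iInter.1 hu m).1, (Set.mem_iInter.1 hu 0).2⟩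

theorem pullbackLimit_subset_image_backComp {ω : Ω}
    (h : ∀ k, pullbackLimit S f X (S^[k] ω) ⊆
      f (S^[k + 1] ω) '' pullbackLimit S f X (S^[k + 1] ω)) (m : ℕ) :
    pullbackLimit S f X ω ⊆ backComp S f m ω '' pullbackLimit S f X (S^[m + 1] ω) := by
  induction m with
  | zero => exact h 0
  | succ m ih =>
    refine ih.trans ((Set.image_mono (h (m + 1))).trans ?_)
    rw [Set.image_image]
    rfl

/-- Where the backward composition is strictly non-expansive, the diameter of the pullback limit
strictly increases into the past. -/
theorem extDiam_pullbackLimit_lt {Y : Ω → Set V} {ρ : Ω → V → V → ℝ} {ω : Ω} {m : ℕ}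
    (hρ : IsMetricOn (Y ω) (ρ ω)) (hX : ∀ ω, (X ω).Nonempty)
    (hfX : ∀ ω, ∀ x ∈ X (S ω), f (S ω) x ∈ X ω)
    (hK : ∃ M, ∀ m, M ≤ m → backImage S f X m ω ⊆ Y ω ∧
      SeqCompactFor (ρ ω) (backImage S f X m ω))
    (himage : pullbackLimit S f X ω ⊆ backComp S f m ω '' pullbackLimit S f X (S^[m + 1] ω))
    (hY : pullbackLimit S f X (S^[m + 1] ω) ⊆ Y (S^[m + 1] ω))
    (hlt : ∀ x ∈ Y (S^[m + 1] ω), ∀ y ∈ Y (S^[m + 1] ω), x ≠ y →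
      ρ ω (backComp S f m ω x) (backComp S f m ω y) < ρ (S^[m + 1] ω) x y)
    (hpos : 0 < extDiam (Y ω) (ρ ω) (pullbackLimit S f X ω)) :
    extDiam (Y ω) (ρ ω) (pullbackLimit S f X ω) <
      extDiam (Y (S^[m + 1] ω)) (ρ (S^[m + 1] ω)) (pullbackLimit S f X (S^[m + 1] ω)) := by
  obtain ⟨x, hx, y, hy, hmax⟩ := hρ.exists_max_iInter (antitone_backImage hfX ω)
    (fun m => (hX _).image _) hK
  obtain ⟨M, hM⟩ := hK
  have hsub : pullbackLimit S f X ω ⊆ Y ω := (Set.iInter_subset _ M).trans (hM M le_rfl).1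
  have hle : extDiam (Y ω) (ρ ω) (pullbackLimit S f X ω) ≤ ENNReal.ofReal (ρ ω x y) := by
    refine iSup₂_le fun x' hx' => iSup₂_le fun y' hy' => ?_
    rw [if_pos ⟨hsub hx', hsub hy'⟩]
    exact ENNReal.ofReal_le_ofReal (hmax x' hx' y' hy')
  have hxy : 0 < ρ ω x y := ENNReal.ofReal_pos.1 (hpos.trans_le hle)
  obtain ⟨u, hu, rfl⟩ := himage hx
  obtain ⟨v, hv, rfl⟩ := himage hy
  have huv : u ≠ v := by
    rintro rfl
    exact hxy.ne' ((hρ.eq_zero_iff _ (hsub hx) _ (hsub hx)).2 rfl)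
  have hd := hlt u (hY hu) v (hY hv) huv
  calc _ ≤ _ := hle
    _ < ENNReal.ofReal (ρ (S^[m + 1] ω) u v) :=
      (ENNReal.ofReal_lt_ofReal_iff (hxy.trans hd)).2 hd
    _ ≤ _ := ofReal_le_extDiam hY hu hv

theorem Measurable.comp_fst_map {Ω' W : Type*} [MeasurableSpace Ω] [MeasurableSpace Ω']
    [MeasurableSpace V] [MeasurableSpace W] {S : Ω → Ω'} (hS : Measurable S) {g : Ω' → V → W}
    (hg : Measurable fun p : Ω' × V => g p.1 p.2) : Measurable fun p : Ω × V => g (S p.1) p.2 :=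
  hg.comp (hS.prodMap measurable_id)

theorem measurable_backComp [MeasurableSpace Ω] [MeasurableSpace V] (hS : Measurable S)
    (hf : Measurable fun p : Ω × V => f (S p.1) p.2) (m : ℕ) :
    Measurable fun p : Ω × V => backComp S f m p.1 p.2 := by
  induction m with
  | zero => exact hf
  | succ m ih =>
    have hstep : Measurable fun p : Ω × V => f (S (S^[m + 1] p.1)) p.2 :=
      hf.comp (((hS.iterate (m + 1)).comp measurable_fst).prodMk measurable_snd)
    simp only [backComp, Function.iterate_succ_apply' S (m + 1)]
    exact ih.comp (measurable_fst.prodMk hstep)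

/-- A random pullback limit hits measurable sets on measurable events. -/
theorem measurableSet_exists_mem_pullbackLimit [MeasurableSpace Ω] [MeasurableSpace V]
    [StandardBorelSpace V] (P : Measure Ω) [IsFiniteMeasure P] [P.IsComplete]
    (hS : Measurable S) (hf : Measurable fun p : Ω × V => f (S p.1) p.2)
    (hX : MeasurableSet {p : Ω × V | p.2 ∈ X p.1}) {R : Set (Ω × V × V)}
    (hR : MeasurableSet R) :
    MeasurableSet {ω | ∃ x ∈ pullbackLimit S f X ω, ∃ y ∈ pullbackLimit S f X ω,
      (ω, x, y) ∈ R} := by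
  let Q : Set (Ω × V × (ℕ → V)) :=
    ⋂ m, {p | p.2.2 m ∈ X (S^[m + 1] p.1)} ∩ {p | backComp S f m p.1 (p.2.2 m) = p.2.1}
  have hQ : MeasurableSet Q := by
    refine .iInter fun m => .inter ?_ ?_
    · exact (((hS.iterate (m + 1)).comp measurable_fst).prodMk
        (by fun_prop : Measurable fun p : Ω × V × (ℕ → V) => p.2.2 m)) hX
    · exact measurableSet_eq_fun ((measurable_backComp hS hf m).comp (measurable_fst.prodMk
        (by fun_prop : Measurable fun p : Ω × V × (ℕ → V) => p.2.2 m))) (by fun_prop)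
  have hmem : ∀ ω x, x ∈ pullbackLimit S f X ω ↔ ∃ u, (ω, x, u) ∈ Q := by
    intro ω x
    simp only [pullbackLimit, backImage, Q, Set.mem_iInter]
    exact Classical.skolem
  let E : Set (Ω × (V × (ℕ → V)) × (V × (ℕ → V))) :=
    {p | (p.1, p.2.1) ∈ Q} ∩ {p | (p.1, p.2.2) ∈ Q} ∩ {p | (p.1, p.2.1.1, p.2.2.1) ∈ R}
  have hE : MeasurableSet E :=
    (((by fun_prop : Measurable fun p : Ω × (V × (ℕ → V)) × (V × (ℕ → V)) =>
        (p.1, p.2.1)) hQ).inter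
      ((by fun_prop : Measurable fun p : Ω × (V × (ℕ → V)) × (V × (ℕ → V)) =>
        (p.1, p.2.2)) hQ)).inter
      ((by fun_prop : Measurable fun p : Ω × (V × (ℕ → V)) × (V × (ℕ → V)) =>
        (p.1, p.2.1.1, p.2.2.1)) hR)
  convert hE.image_fst_of_isComplete P using 1
  ext ω
  simp only [hmem, Set.mem_image]
  constructor
  · rintro ⟨x, ⟨u, hu⟩, y, ⟨v, hv⟩, h⟩
    exact ⟨(ω, (x, u), (y, v)), ⟨⟨hu, hv⟩, h⟩, rfl⟩
  · rintro ⟨⟨_, ⟨x, u⟩, ⟨y, v⟩⟩, ⟨⟨hu, hv⟩, h⟩, rfl⟩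
    exact ⟨x, ⟨u, hu⟩, y, ⟨v, hv⟩, h⟩

end BackwardImages

/-- **Theorem 3(ii): stochastic fixed-point principle, uniqueness.** Under (A1)–(A3) the
`ℱ₀`-measurable solution `ξ` (with values in `Y(ω)`) of `ξ(Tω) = f(ω, ξ(ω))` a.s. is
such that any (not necessarily measurable) `η` with `η(ω) ∈ X(ω)` solving the same
equation a.s. coincides with `ξ` almost surely; in particular any two such solutions
coincide almost surely. -/
theorem stochastic_fixed_point_uniqueness
    {Ω : Type} [inst : MeasurableSpace Ω] {V : Type} [MeasurableSpace V]
    [StandardBorelSpace V]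
    (P : Measure Ω) [IsProbabilityMeasure P] (hPcomplete : P.IsComplete)
    -- `T` is an automorphism of the probability space
    (T : Ω ≃ Ω) (hT : Measurable T) (hTinv : Measurable T.symm)
    (hTP : MeasurePreserving T P P)
    -- the filtration `(ℱ_t)`, invariant under `T` and containing the null sets
    (F : ℤ → MeasurableSpace Ω) (hFle : ∀ t, F t ≤ inst) (hFmono : Monotone F)
    (hFshift : ∀ t, F (t + 1) = (F t).comap T)
    (hFnull : ∀ t, ∀ N : Set Ω, P N = 0 → MeasurableSet[F t] N)
    -- the random set `X(ω)`, nonempty, with `ℱ₀ × 𝒱`-measurable graph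
    (X : Ω → Set V) (hXne : ∀ ω, (X ω).Nonempty)
    (hXgraph : MeasurableSet[(F 0).prod (inferInstance : MeasurableSpace V)]
      {p : Ω × V | p.2 ∈ X p.1})
    -- `f(ω, ·)` maps `X(ω)` into `X(Tω)`
    (f : Ω → V → V) (hfmaps : ∀ ω, ∀ x ∈ X ω, f ω x ∈ X (T ω))
    -- (A1): the extension `f̄` (with value the adjoined point `∞` off the graph)
    -- is `ℱ₁ × 𝒱`-measurable
    (hA1 : @Measurable (Ω × V) (V ⊕ Unit) ((F 1).prod inferInstance) inferInstance
      (fun p => if p.2 ∈ X p.1 then Sum.inl (f p.1 p.2) else Sum.inr ()))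
    -- the random set `Y(ω) ⊆ X(ω)` with its separable metric `ρ(ω, ·, ·)`
    (Y : Ω → Set V) (hYsub : ∀ ω, Y ω ⊆ X ω) (hYne : ∀ ω, (Y ω).Nonempty)
    (ρ : Ω → V → V → ℝ)
    (hρmetric : ∀ ω, ∀ x ∈ Y ω, ∀ y ∈ Y ω,
      0 ≤ ρ ω x y ∧ (ρ ω x y = 0 ↔ x = y) ∧ ρ ω x y = ρ ω y x)
    (hρtriangle : ∀ ω, ∀ x ∈ Y ω, ∀ y ∈ Y ω, ∀ z ∈ Y ω, ρ ω x z ≤ ρ ω x y + ρ ω y z)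
    (hρsep : ∀ ω, ∃ s : Set V, s.Countable ∧ s ⊆ Y ω ∧
      ∀ x ∈ Y ω, ∀ ε : ℝ, 0 < ε → ∃ z ∈ s, ρ ω x z < ε)
    -- (A2)(a): the graph of `Y` is `ℱ₀ × 𝒱`-measurable
    (hA2a : MeasurableSet[(F 0).prod (inferInstance : MeasurableSpace V)]
      {p : Ω × V | p.2 ∈ Y p.1})
    -- (A2)(b): the extension `ρ̄` (equal to `+∞` off `Y(ω) × Y(ω)`) is
    -- `ℱ₀ × 𝒱 × 𝒱`-measurable
    (hA2b : @Measurable (Ω × V × V) ℝ≥0∞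
      ((F 0).prod ((inferInstance : MeasurableSpace V).prod inferInstance)) inferInstance
      (fun p => if p.2.1 ∈ Y p.1 ∧ p.2.2 ∈ Y p.1
        then ENNReal.ofReal (ρ p.1 p.2.1 p.2.2) else ⊤))
    -- (A2)(c): on `Y(ω)` the Borel structure of the metric `ρ(ω, ·, ·)` (generated by
    -- its open balls) coincides with the structure induced by `𝒱`
    (hA2c : ∀ ω, MeasurableSpace.comap (fun y : (Y ω) => (y : V))
        (MeasurableSpace.generateFrom
          {s : Set V | ∃ x ∈ Y ω, ∃ ε : ℝ, 0 < ε ∧ s = {y | y ∈ Y ω ∧ ρ ω x y < ε}})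
      = MeasurableSpace.comap (fun y : (Y ω) => (y : V))
          (inferInstance : MeasurableSpace V))
    -- (A2)(d): `f(ω, ·)` maps `Y(ω)` into `Y(Tω)` continuously for the metrics
    (hA2d : ∀ ω, ∀ x ∈ Y ω, f ω x ∈ Y (T ω))
    (hA2dcont : ∀ ω, ∀ x ∈ Y ω, ∀ ε : ℝ, 0 < ε → ∃ δ : ℝ, 0 < δ ∧
      ∀ y ∈ Y ω, ρ ω x y < δ → ρ (T ω) (f ω x) (f ω y) < ε)
    -- (A3): the `ℱ₀`-measurable sets `Ω₀ ⊆ Ω₁ ⊆ …` with `P(Ω_m) → 1`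
    (Ωs : ℕ → Set Ω) (hΩmeas : ∀ m, MeasurableSet[F 0] (Ωs m)) (hΩmono : Monotone Ωs)
    (hΩP : Tendsto (fun m => P (Ωs m)) atTop (nhds 1))
    -- (A3)(a): for `ω ∈ Ω_m`, `X^{(m)}(ω) = f^{(m)}(ω, X₋ₘ₋₁(ω))` lies in `Y(ω)` and is
    -- compact in the metric `ρ(ω, ·, ·)` (formulated via sequential compactness)
    (hA3a : ∀ m, ∀ ω ∈ Ωs m,
      backComp (⇑T.symm) f m ω '' X ((⇑T.symm)^[m + 1] ω) ⊆ Y ω ∧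
      ∀ u : ℕ → V, (∀ k, u k ∈ backComp (⇑T.symm) f m ω '' X ((⇑T.symm)^[m + 1] ω)) →
        ∃ z ∈ backComp (⇑T.symm) f m ω '' X ((⇑T.symm)^[m + 1] ω),
          ∃ σ : ℕ → ℕ, StrictMono σ ∧ Tendsto (fun k => ρ ω z (u (σ k))) atTop (nhds 0))
    -- (A3)(b): on `Ω_m` the map `f^{(m)}(ω, ·)` is strictly non-expansive
    (hA3b : ∀ m, ∀ ω ∈ Ωs m, ∀ x ∈ Y ((⇑T.symm)^[m + 1] ω), ∀ y ∈ Y ((⇑T.symm)^[m + 1] ω),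
      x ≠ y → ρ ω (backComp (⇑T.symm) f m ω x) (backComp (⇑T.symm) f m ω y)
        < ρ ((⇑T.symm)^[m + 1] ω) x y)
    -- the `ℱ₀`-measurable function `m(ω)` with `ω ∈ Ω_m` for all `m ≥ m(ω)`, a.s.
    (mω : Ω → ℕ) (hmωmeas : Measurable[F 0] mω)
    (hmω : ∀ᵐ ω ∂P, ∀ m, mω ω ≤ m → ω ∈ Ωs m) :
    ∃ ξ : Ω → V, Measurable[F 0] ξ ∧ (∀ ω, ξ ω ∈ Y ω) ∧
      (∀ᵐ ω ∂P, ξ (T ω) = f ω (ξ ω)) ∧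
      ∀ η : Ω → V, (∀ ω, η ω ∈ X ω) → (∀ᵐ ω ∂P, η (T ω) = f ω (η ω)) →
        ∀ᵐ ω ∂P, η ω = ξ ω := by
  set S : Ω → Ω := ⇑T.symm with hSdef
  have hTS : ∀ ω, T (S ω) = ω := T.apply_symm_apply
  have hSP : MeasurePreserving S P P := MeasurePreserving.symm ⟨T, hT, hTinv⟩ hTP
  have hS01 : Measurable[F 0, F 1] S := by
    intro A hA
    have h01 := hFshift 0
    rw [zero_add] at h01
    rw [h01] at hA
    obtain ⟨B, hB, rfl⟩ := hA
    convert hB using 1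
    ext ω
    simp [hSdef]
  have hS00 : Measurable[F 0, F 0] S := fun A hA => hS01 (hFmono zero_le_one A hA)
  have hfX : ∀ ω, ∀ x ∈ X (S ω), f (S ω) x ∈ X ω := fun ω x hx => by
    simpa only [hTS] using hfmaps (S ω) x hx
  have hfY : ∀ ω, ∀ x ∈ Y (S ω), f (S ω) x ∈ Y ω := fun ω x hx => by
    simpa only [hTS] using hA2d (S ω) x hx
  have hcont : ∀ ω, ∀ x ∈ Y (S ω), ∀ ε : ℝ, 0 < ε → ∃ δ : ℝ, 0 < δ ∧
      ∀ y ∈ Y (S ω), ρ (S ω) x y < δ → ρ ω (f (S ω) x) (f (S ω) y) < ε := fun ω => by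
    simpa only [hTS] using hA2dcont (S ω)
  have hρ : ∀ ω, IsMetricOn (Y ω) (ρ ω) := fun ω =>
    ⟨fun x hx y hy => (hρmetric ω x hx y hy).1, fun x hx y hy => (hρmetric ω x hx y hy).2.1,
      fun x hx y hy => (hρmetric ω x hx y hy).2.2, hρtriangle ω⟩
  -- a total extension of `f` off the graph of `X`
  obtain ⟨ω₀⟩ := nonempty_of_isProbabilityMeasure P
  obtain ⟨v₀, -⟩ := hXne ω₀
  let g : Ω → V → V := fun ω x => if x ∈ X ω then f ω x else v₀
  have hgf : ∀ ω, ∀ x ∈ X ω, g ω x = f ω x := fun ω x hx => if_pos hx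
  have hg1 : @Measurable (Ω × V) V ((F 1).prod inferInstance) inferInstance
      (fun p => g p.1 p.2) := by
    have h : Measurable (Sum.elim id fun _ => v₀ : V ⊕ Unit → V) :=
      measurable_id.sumElim measurable_const
    convert h.comp hA1 using 1
    ext p
    by_cases hp : p.2 ∈ X p.1 <;> simp [g, hp]
  have hg0 : @Measurable (Ω × V) V ((F 0).prod inferInstance) inferInstance
      (fun p => g (S p.1) p.2) :=
    @Measurable.comp_fst_map Ω V Ω V (F 0) (F 1) _ _ _ hS01 _ hg1
  -- the restriction of `P` to `ℱ₀` is complete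
  have hnull : ∀ N : Set Ω, P N = 0 → MeasurableSet[F 0] N := hFnull 0
  have hcomplete : (P.trim (hFle 0)).IsComplete :=
    ⟨fun N hN => hnull N (le_antisymm ((le_trim (hFle 0)).trans hN.le) bot_le)⟩
  have hhit : ∀ R : Set (Ω × V × V),
      MeasurableSet[(F 0).prod ((inferInstance : MeasurableSpace V).prod inferInstance)] R →
      MeasurableSet[F 0] {ω | ∃ x ∈ pullbackLimit S f X ω, ∃ y ∈ pullbackLimit S f X ω,
        (ω, x, y) ∈ R} := by
    intro R hR
    have := @measurableSet_exists_mem_pullbackLimit Ω V S g X (F 0) _ _ (P.trim (hFle 0)) _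
      hcomplete hS00 hg0 hXgraph R hR
    simpa only [pullbackLimit_congr hfX hgf] using this
  let D : Ω → ℝ≥0∞ := fun ω => extDiam (Y ω) (ρ ω) (pullbackLimit S f X ω)
  have hD : Measurable[F 0] D := by
    refine @measurable_of_Ioi _ _ _ _ _ (F 0) _ _ _ _ fun c => ?_
    convert hhit _ (hA2b (measurableSet_Ioi (a := c))) using 1
    ext ω
    exact lt_extDiam_iff
  -- almost every backward orbit is good
  have hgood : ∀ᵐ ω ∂P, ∀ k m, mω (S^[k] ω) ≤ m → S^[k] ω ∈ Ωs m :=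
    ae_all_iff.2 fun k => (hSP.quasiMeasurePreserving.iterate k).ae hmω
  have hK : ∀ ω, (∀ m, mω ω ≤ m → ω ∈ Ωs m) → ∃ M, ∀ m, M ≤ m →
      backImage S f X m ω ⊆ Y ω ∧ SeqCompactFor (ρ ω) (backImage S f X m ω) :=
    fun ω h => ⟨mω ω, fun m hm => hA3a m ω (h m hm)⟩
  have hsub : ∀ ω, (∀ m, mω ω ≤ m → ω ∈ Ωs m) → pullbackLimit S f X ω ⊆ Y ω := fun ω h =>
    (Set.iInter_subset _ _).trans (hA3a (mω ω) ω (h _ le_rfl)).1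
  have hne : ∀ ω, (∀ m, mω ω ≤ m → ω ∈ Ωs m) → (pullbackLimit S f X ω).Nonempty := by
    intro ω h
    obtain ⟨x, hx, -⟩ := (hρ ω).exists_max_iInter (antitone_backImage hfX ω)
      (fun m => (hXne _).image _) (hK ω h)
    exact ⟨x, hx⟩
  have hstep : ∀ ω, (∀ m, mω (S ω) ≤ m → S ω ∈ Ωs m) →
      pullbackLimit S f X ω ⊆ f (S ω) '' pullbackLimit S f X (S ω) := fun ω h =>
    pullbackLimit_subset_image (hρ ω) (hρ (S ω)) hfX (hfY ω) (hcont ω) (hK _ h)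
  have hD0 : ∀ᵐ ω ∂P, D ω = 0 := by
    refine hSP.conservative.ae_eq_zero_of_eventually_lt (hD.mono (hFle 0) le_rfl) ?_
    filter_upwards [hgood] with ω hω hpos
    filter_upwards [eventually_gt_atTop (mω ω)] with n hn
    obtain ⟨m, rfl⟩ : ∃ m, n = m + 1 := ⟨n - 1, by lia⟩
    refine extDiam_pullbackLimit_lt (hρ ω) hXne hfX (hK ω (hω 0))
      (pullbackLimit_subset_image_backComp (fun k => ?_) m) (hsub _ (hω (m + 1)))
      (hA3b m ω (hω 0 m (Nat.lt_succ_iff.1 hn))) hpos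
    have h := hω (k + 1)
    simp only [Function.iterate_succ_apply'] at h ⊢
    exact hstep _ h
  -- the solution is the unique point of the pullback limit
  choose y₀ hy₀ using hYne
  let ξ : Ω → V := fun ω =>
    if h : (pullbackLimit S f X ω).Nonempty ∧ pullbackLimit S f X ω ⊆ Y ω then h.1.some else y₀ ω
  have hξY : ∀ ω, ξ ω ∈ Y ω := by
    intro ω
    by_cases h : (pullbackLimit S f X ω).Nonempty ∧ pullbackLimit S f X ω ⊆ Y ω
    · simpa only [ξ, dif_pos h] using h.2 h.1.some_mem
    · simpa only [ξ, dif_neg h] using hy₀ ω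
  have hξ : ∀ᵐ ω ∂P, pullbackLimit S f X ω = {ξ ω} := by
    filter_upwards [hgood, hD0] with ω hω h0
    have h := And.intro (hne ω (hω 0)) (hsub ω (hω 0))
    have hmem : ξ ω ∈ pullbackLimit S f X ω := by
      simpa only [ξ, dif_pos h] using h.1.some_mem
    exact ((hρ ω).subsingleton_of_extDiam_eq_zero h.2 h0).eq_singleton_of_mem hmem
  refine ⟨ξ, fun B hB => ?_, hξY, ?_, fun η hηX hη => ?_⟩
  · have hR : MeasurableSet[F 0] {ω | ∃ x ∈ pullbackLimit S f X ω,
        ∃ y ∈ pullbackLimit S f X ω, x ∈ B} :=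
      hhit {p | p.2.1 ∈ B} ((@measurable_snd Ω (V × V) (F 0) _) (measurable_fst hB))
    have hae : {ω | ∃ x ∈ pullbackLimit S f X ω, ∃ y ∈ pullbackLimit S f X ω, x ∈ B}
        =ᵐ[P] ξ ⁻¹' B := by
      refine Filter.eventuallyEq_set.2 ?_
      filter_upwards [hξ] with ω hω
      simp [hω]
    obtain ⟨h1, h2⟩ := ae_eq_set.1 hae
    have := (hR.diff (hnull _ h1)).union (hnull _ h2)
    rw [sdiff_sdiff_right_self, inf_comm] at this
    exact Set.inter_union_sdiff (ξ ⁻¹' B) _ ▸ this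
  · filter_upwards [hξ, hTP.quasiMeasurePreserving.ae hξ,
      hgood] with ω h1 h2 hω
    have hSTω : S (T ω) = ω := T.symm_apply_apply ω
    have := hstep (T ω) (by rw [hSTω]; exact hω 0)
    rw [hSTω, h1, h2, Set.image_singleton, Set.singleton_subset_singleton] at this
    exact this
  · have horbit : ∀ᵐ ω ∂P, ∀ k : ℕ, η (T (S^[k + 1] ω)) = f (S^[k + 1] ω) (η (S^[k + 1] ω)) :=
      ae_all_iff.2 fun k => (hSP.quasiMeasurePreserving.iterate (k + 1)).ae hη
    filter_upwards [hξ, horbit] with ω h1 h2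
    have : η ω ∈ pullbackLimit S f X ω := mem_pullbackLimit_of_orbit hηX fun k => by
      have h := h2 k
      rw [Function.iterate_succ_apply', hTS] at h
      rwa [Function.iterate_succ_apply']
    rwa [h1] at this
end
end

section
/- Under the stated assumptions (D1)–(D3) and (C), there exists a nondecreasing sequence of ℱ₀-measurable sets Γ₁ ⊆ Γ₂ ⊆ … ⊆ Ω with P(Γ_m) → 1 such that for each m = 1, 2, … and each ω ∈ Γ_m, the mapping C(m, T^{−m}ω) from the cone K₋ₘ(ω) to the cone K₀(ω) is strictly monotone. -/
open MeasureTheory Filter Topology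
open scoped ENNReal Classical

noncomputable section

/-- A cone: a set containing all nonnegative linear combinations of its elements. -/
def IsCone {E : Type*} [AddCommGroup E] [Module ℝ E] (K : Set E) : Prop :=
  ∀ x ∈ K, ∀ y ∈ K, ∀ a b : ℝ, 0 ≤ a → 0 ≤ b → a • x + b • y ∈ K

/-- A solid cone: a closed proper cone with nonempty interior. -/
def IsSolidCone {E : Type*} [NormedAddCommGroup E] [NormedSpace ℝ E] (K : Set E) : Prop :=
  IsCone K ∧ IsClosed K ∧ K ∩ (-K) = {0} ∧ (interior K).Nonempty

/-- `x ≤_K y` iff `y - x ∈ K`. -/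
def coneLE {E : Type*} [AddCommGroup E] (K : Set E) (x y : E) : Prop := y - x ∈ K

/-- `x ≺_K y` iff `x ≤_K y` and `x ≠ y`. -/
def conePrec {E : Type*} [AddCommGroup E] (K : Set E) (x y : E) : Prop :=
  coneLE K x y ∧ x ≠ y

/-- `x <_K y` iff `y - x ∈ K°`. -/
def coneLT {E : Type*} [NormedAddCommGroup E] (K : Set E) (x y : E) : Prop :=
  y - x ∈ interior K

/-- A map `D : K → L` is completely monotone if it preserves each of the three
order relations `≤_K`, `≺_K`, `<_K`. -/
def CompletelyMonotoneOn {E : Type*} [NormedAddCommGroup E] (K L : Set E) (D : E → E) : Prop :=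
  (∀ x ∈ K, ∀ y ∈ K, coneLE K x y → coneLE L (D x) (D y)) ∧
  (∀ x ∈ K, ∀ y ∈ K, conePrec K x y → conePrec L (D x) (D y)) ∧
  (∀ x ∈ K, ∀ y ∈ K, coneLT K x y → coneLT L (D x) (D y))

/-- A map `D : K → L` is strictly monotone if `x ≺_K y` implies `D x <_L D y`. -/
def ConeStrictlyMonotoneOn {E : Type*} [NormedAddCommGroup E] (K L : Set E) (D : E → E) : Prop :=
  ∀ x ∈ K, ∀ y ∈ K, conePrec K x y → coneLT L (D x) (D y)

/-- The dual cone `K* = {φ : φ(x) ≥ 0 for all x ∈ K}`. -/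
def dualCone {E : Type*} [NormedAddCommGroup E] [NormedSpace ℝ E] (K : Set E) :
    Set (E →L[ℝ] ℝ) := {φ | ∀ x ∈ K, 0 ≤ φ x}

/-- Points of a solid cone are limits of points of the cone lying in a given dense set. -/
theorem IsSolidCone.subset_closure_inter_dense {E : Type*} [NormedAddCommGroup E]
    [NormedSpace ℝ E] {K : Set E} (hK : IsSolidCone K) {s : Set E} (hs : Dense s) :
    K ⊆ closure (K ∩ s) := by
  obtain ⟨hcone, hcl, -, hne⟩ := hK
  have hconv : Convex ℝ K := fun x hx y hy a b ha hb _ => hcone x hx y hy a b ha hb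
  have h1 : closure (interior K) = closure K :=
    hconv.closure_interior_eq_closure_of_nonempty_interior hne
  calc K ⊆ closure (interior K) := h1 ▸ subset_closure
    _ ⊆ closure (interior K ∩ s) := closure_minimal
        (hs.open_subset_closure_inter isOpen_interior) isClosed_closure
    _ ⊆ closure (K ∩ s) := closure_mono (Set.inter_subset_inter_left _ interior_subset)

theorem IsSolidCone.add_mem {E : Type*} [NormedAddCommGroup E] [NormedSpace ℝ E] {K : Set E}
    (hK : IsSolidCone K) {x y : E} (hx : x ∈ K) (hy : y ∈ K) : x + y ∈ K := by
  simpa using hK.1 x hx y hy 1 1 zero_le_one zero_le_one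

theorem ConeStrictlyMonotoneOn.congr {E : Type*} [NormedAddCommGroup E] {K L : Set E}
    {f g : E → E} (hf : ConeStrictlyMonotoneOn K L f) (hfg : Set.EqOn f g K) :
    ConeStrictlyMonotoneOn K L g := fun x hx y hy hxy => by
  simpa only [hfg hx, hfg hy] using hf x hx y hy hxy

/-- Strict monotonicity of a continuous map on a solid cone can be tested on a dense sequence. -/
theorem coneStrictlyMonotoneOn_iff_denseRange {E : Type*} [NormedAddCommGroup E]
    [NormedSpace ℝ E] [FiniteDimensional ℝ E] {K L : Set E} (hK : IsSolidCone K)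
    (hL : IsClosed L) {f : E → E} (hf : ContinuousOn f K) {q : ℕ → E} (hq : DenseRange q) :
    ConeStrictlyMonotoneOn K L f ↔ ∀ j : ℕ, ∃ k : ℕ, ∀ a b c : ℕ,
      ¬ (q a ∈ K ∧ q b ∈ K ∧ q c ∉ L ∧ ‖q a‖ ≤ j ∧ ‖q b‖ ≤ j ∧ 1 / ((j : ℝ) + 1) ≤ ‖q b‖ ∧
        ‖f (q a + q b) - f (q a) - q c‖ < 1 / ((k : ℝ) + 1)) := by
  have : ProperSpace E := FiniteDimensional.proper ℝ E
  have hg : ContinuousOn (fun p : E × E => f (p.1 + p.2) - f p.1) (K ×ˢ K) := by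
    refine (hf.comp (by fun_prop) ?_).sub (hf.comp (by fun_prop) ?_)
    · exact fun p hp => hK.add_mem hp.1 hp.2
    · exact fun p hp => hp.1
  constructor
  · intro h j
    set S : Set (E × E) := (K ∩ Metric.closedBall 0 j) ×ˢ
      ((K ∩ Metric.closedBall 0 j) ∩ {z | 1 / ((j : ℝ) + 1) ≤ ‖z‖}) with hS
    have hSc : IsCompact S := by
      have h1 : IsCompact (K ∩ Metric.closedBall (0 : E) j) :=
        (isCompact_closedBall _ _).inter_left hK.2.1
      exact h1.prod (h1.inter_right (isClosed_le continuous_const continuous_norm))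
    have himg : IsCompact ((fun p : E × E => f (p.1 + p.2) - f p.1) '' S) :=
      hSc.image_of_continuousOn (hg.mono fun p hp => ⟨hp.1.1, hp.2.1.1⟩)
    have hsub : (fun p : E × E => f (p.1 + p.2) - f p.1) '' S ⊆ interior L := by
      rintro _ ⟨⟨x, z⟩, ⟨⟨hx, -⟩, ⟨hz, -⟩, hz0⟩, rfl⟩
      refine h x hx (x + z) (hK.add_mem hx hz) ⟨by simpa [coneLE] using hz, fun hxz => ?_⟩
      have hz' : z = 0 := by simpa using hxz.symm
      have : (0 : ℝ) < 1 / ((j : ℝ) + 1) := by positivity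
      simp only [Set.mem_ofPred_eq, hz', norm_zero] at hz0
      linarith
    obtain ⟨δ, hδ, hthick⟩ := himg.exists_thickening_subset_open isOpen_interior hsub
    obtain ⟨k, hk⟩ := exists_nat_one_div_lt hδ
    refine ⟨k, fun a b c ⟨ha, hb, hc, hja, hjb, hjb', hlt⟩ => hc ?_⟩
    refine interior_subset (hthick ?_)
    refine Metric.mem_thickening_iff.2 ⟨_, ⟨(q a, q b), ⟨⟨ha, ?_⟩, ⟨hb, ?_⟩, hjb'⟩, rfl⟩, ?_⟩
    · simpa using hja
    · simpa using hjb
    · rw [dist_comm, dist_eq_norm]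
      exact hlt.trans hk
  · intro h x hx y _ ⟨hxy, hne⟩
    by_contra hnot
    set z := y - x with hz
    have hzK : z ∈ K := hxy
    have hz0 : 0 < ‖z‖ := norm_pos_iff.2 (sub_ne_zero.2 hne.symm)
    have hy : y = x + z := by simp [hz]
    have hcl : f (x + z) - f x ∈ closure (Lᶜ ∩ Set.range q) := by
      have h1 : f (x + z) - f x ∈ closure Lᶜ := by
        rw [closure_compl, ← hy]
        exact hnot
      exact closure_minimal (Dense.open_subset_closure_inter hq hL.isOpen_compl)
        isClosed_closure h1
    obtain ⟨j₁, hj₁⟩ := exists_nat_gt (max ‖x‖ ‖z‖)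
    obtain ⟨j₂, hj₂⟩ := exists_nat_one_div_lt hz0
    set j := max j₁ j₂
    have hj1 : (j₁ : ℝ) ≤ j := by exact_mod_cast le_max_left _ _
    have hj2 : (j₂ : ℝ) ≤ j := by exact_mod_cast le_max_right _ _
    have hjx : ‖x‖ < j := ((le_max_left _ _).trans_lt hj₁).trans_le hj1
    have hjz : ‖z‖ < j := ((le_max_right _ _).trans_lt hj₁).trans_le hj1
    have hjz' : 1 / ((j : ℝ) + 1) < ‖z‖ := lt_of_le_of_lt (by gcongr) hj₂
    obtain ⟨k, hk⟩ := h j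
    set w : E × E × E := (x, z, f (x + z) - f x)
    set W : Set (E × E × E) := (K ∩ Set.range q) ×ˢ (K ∩ Set.range q) ×ˢ (Lᶜ ∩ Set.range q)
    have hw : w ∈ closure W := by
      rw [closure_prod_eq, closure_prod_eq]
      exact ⟨hK.subset_closure_inter_dense hq hx, hK.subset_closure_inter_dense hq hzK, hcl⟩
    have hcont : ContinuousWithinAt (fun p : E × E × E => ‖f (p.1 + p.2.1) - f p.1 - p.2.2‖)
        W w := by
      have h1 : ContinuousWithinAt (fun p : E × E × E => f (p.1 + p.2.1) - f p.1) W w :=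
        ContinuousWithinAt.comp (g := fun p : E × E => f (p.1 + p.2) - f p.1) (t := K ×ˢ K)
          (f := fun p : E × E × E => (p.1, p.2.1)) (x := w) (hg (x, z) ⟨hx, hzK⟩)
          (Continuous.continuousWithinAt (by fun_prop)) fun p hp => ⟨hp.1.1, hp.2.1.1⟩
      exact (h1.sub (by fun_prop)).norm
    have hev : ∀ᶠ p in 𝓝[W] w, p ∈ W ∧ ‖p.1‖ < j ∧ ‖p.2.1‖ < j ∧ 1 / ((j : ℝ) + 1) < ‖p.2.1‖ ∧
        ‖f (p.1 + p.2.1) - f p.1 - p.2.2‖ < 1 / ((k : ℝ) + 1) := by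
      refine eventually_mem_nhdsWithin.and (.and ?_ (.and ?_ (.and ?_ ?_)))
      · exact nhdsWithin_le_nhds ((isOpen_lt (by fun_prop) continuous_const).mem_nhds hjx)
      · exact nhdsWithin_le_nhds ((isOpen_lt (by fun_prop) continuous_const).mem_nhds hjz)
      · exact nhdsWithin_le_nhds ((isOpen_lt continuous_const (by fun_prop)).mem_nhds hjz')
      · refine hcont.eventually_lt continuousWithinAt_const ?_
        simp only [w, sub_self, norm_zero]
        positivity
    have := mem_closure_iff_nhdsWithin_neBot.1 hw
    obtain ⟨⟨_, _, _⟩, ⟨⟨ha, a, rfl⟩, ⟨hb, b, rfl⟩, ⟨hc, c, rfl⟩⟩, h1, h2, h3, h4⟩ := hev.exists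
    exact hk a b c ⟨ha, hb, hc, h1.le, h2.le, h3.le, h4⟩

/-- Strict monotonicity of a random continuous map between random solid cones is an event. -/
theorem measurableSet_coneStrictlyMonotoneOn {Ω E : Type*} [MeasurableSpace Ω]
    [NormedAddCommGroup E] [NormedSpace ℝ E] [FiniteDimensional ℝ E] [MeasurableSpace E]
    [BorelSpace E] {K L : Ω → Set E} (hK : ∀ ω, IsSolidCone (K ω)) (hL : ∀ ω, IsClosed (L ω))
    {f g : Ω → E → E} (hf : ∀ ω, ContinuousOn (f ω) (K ω))
    (hKm : ∀ x, MeasurableSet {ω | x ∈ K ω}) (hLm : ∀ x, MeasurableSet {ω | x ∈ L ω})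
    (hg : ∀ x, Measurable fun ω => g ω x) (hfg : ∀ ω, Set.EqOn (f ω) (g ω) (K ω)) :
    MeasurableSet {ω | ConeStrictlyMonotoneOn (K ω) (L ω) (f ω)} := by
  have : ProperSpace E := FiniteDimensional.proper ℝ E
  have hiff : ∀ ω, ConeStrictlyMonotoneOn (K ω) (L ω) (f ω) ↔
      ConeStrictlyMonotoneOn (K ω) (L ω) (g ω) := fun ω =>
    ⟨fun h => h.congr (hfg ω), fun h => h.congr (hfg ω).symm⟩
  simp only [hiff, coneStrictlyMonotoneOn_iff_denseRange (hK _) (hL _)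
    ((hf _).congr (hfg _).symm) (TopologicalSpace.denseRange_denseSeq E), Set.ofPred_forall,
    Set.ofPred_exists]
  refine MeasurableSet.iInter fun j => MeasurableSet.iUnion fun k => MeasurableSet.iInter fun a =>
    MeasurableSet.iInter fun b => MeasurableSet.iInter fun c => MeasurableSet.compl ?_
  refine (hKm _).inter ((hKm _).inter ((hLm _).compl.inter ((MeasurableSet.const _).inter
    ((MeasurableSet.const _).inter ((MeasurableSet.const _).inter ?_)))))
  exact measurableSet_lt (((hg _).sub (hg _)).sub_const _).norm measurable_const

/-- **Lemma 1.** There is a nondecreasing sequence of `ℱ₀`-measurable sets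
`Γ₁ ⊆ Γ₂ ⊆ …` with `P(Γ_m) → 1` such that for every `m ≥ 1` and `ω ∈ Γ_m` the
mapping `C(m, T⁻ᵐω) : K₋ₘ(ω) → K₀(ω)` is strictly monotone. -/
theorem exists_strictly_monotone_backward_cocycle_sets
    {n : ℕ} {Ω : Type} [inst : MeasurableSpace Ω]
    [MeasurableSpace (EuclideanSpace ℝ (Fin n) →L[ℝ] ℝ)]
    [BorelSpace (EuclideanSpace ℝ (Fin n) →L[ℝ] ℝ)]
    (P : Measure Ω) [IsProbabilityMeasure P] (hPcomplete : P.IsComplete)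
    -- `T` is an automorphism of the probability space
    (T : Ω ≃ Ω) (hT : Measurable T) (hTinv : Measurable T.symm)
    (hTP : MeasurePreserving T P P)
    -- the filtration `(ℱ_t)`, invariant under `T` and containing the null sets
    (F : ℤ → MeasurableSpace Ω) (hFle : ∀ t, F t ≤ inst) (hFmono : Monotone F)
    (hFshift : ∀ t, F (t + 1) = (F t).comap T)
    (hFnull : ∀ t, ∀ N : Set Ω, P N = 0 → MeasurableSet[F t] N)
    -- the random solid cone `K(ω)`, `ℱ₀`-measurable
    (K : Ω → Set (EuclideanSpace ℝ (Fin n)))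
    (hKsolid : ∀ ω, IsSolidCone (K ω))
    (hKgraph : MeasurableSet[(F 0).prod
        (inferInstance : MeasurableSpace (EuclideanSpace ℝ (Fin n)))]
      {p : Ω × EuclideanSpace ℝ (Fin n) | p.2 ∈ K p.1})
    -- the random mapping `D(ω, ·) : K₀(ω) → K₁(ω)`
    (D : Ω → EuclideanSpace ℝ (Fin n) → EuclideanSpace ℝ (Fin n))
    (hDmaps : ∀ ω, ∀ x ∈ K ω, D ω x ∈ K (T ω))
    -- (D1): continuity in `x` and joint `ℱ₁ × 𝒱`-measurability of the extension `D̄`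
    (hD1cont : ∀ ω, ContinuousOn (D ω) (K ω))
    (hD1meas : @Measurable (Ω × EuclideanSpace ℝ (Fin n)) (EuclideanSpace ℝ (Fin n) ⊕ Unit)
      ((F 1).prod inferInstance) inferInstance
      (fun p => if p.2 ∈ K p.1 then Sum.inl (D p.1 p.2) else Sum.inr ()))
    -- (D2): positive homogeneity of degree one
    (hD2 : ∀ ω, ∀ l : ℝ, 0 < l → ∀ x ∈ K ω, D ω (l • x) = l • D ω x)
    -- (D3): complete monotonicity
    (hD3 : ∀ ω, CompletelyMonotoneOn (K ω) (K (T ω)) (D ω))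
    -- the cocycle `C(t, ω) = D_t(ω) ∘ … ∘ D₁(ω)`
    (C : ℕ → Ω → EuclideanSpace ℝ (Fin n) → EuclideanSpace ℝ (Fin n))
    (hC0 : ∀ ω, C 0 ω = id)
    (hCrec : ∀ t ω, C (t + 1) ω = D ((⇑T)^[t] ω) ∘ C t ω)
    -- (C): for a.e. `ω` some `C(l_ω, ω)` is strictly monotone
    (hCstrict : ∀ᵐ ω ∂P, ∃ l : ℕ, 0 < l ∧
      ConeStrictlyMonotoneOn (K ω) (K ((⇑T)^[l] ω)) (C l ω))
 :
    ∃ Γ : ℕ → Set Ω,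
      (∀ m, MeasurableSet[F 0] (Γ m)) ∧ Monotone Γ ∧
      Tendsto (fun m => P (Γ m)) atTop (nhds 1) ∧
      ∀ m : ℕ, 1 ≤ m → ∀ ω ∈ Γ m,
        ConeStrictlyMonotoneOn (K ((⇑T.symm)^[m] ω)) (K ω) (C m ((⇑T.symm)^[m] ω)) := by
  have hinv : ∀ m ω, (⇑T)^[m] ((⇑T.symm)^[m] ω) = ω := fun m ω =>
    (Function.LeftInverse.iterate T.apply_symm_apply m) ω
  have hinv' : ∀ m ω, (⇑T.symm)^[m] ((⇑T)^[m] ω) = ω := fun m ω =>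
    (Function.LeftInverse.iterate T.symm_apply_apply m) ω
  have hCmaps : ∀ k ω, Set.MapsTo (C k ω) (K ω) (K ((⇑T)^[k] ω)) := by
    intro k ω
    induction k with
    | zero => simp [hC0, Set.mapsTo_id]
    | succ k ih =>
      intro x hx
      rw [hCrec, Function.iterate_succ_apply']
      exact hDmaps _ _ (ih hx)
  have hCcont : ∀ k ω, ContinuousOn (C k ω) (K ω) := by
    intro k ω
    induction k with
    | zero => rw [hC0]; exact continuousOn_id
    | succ k ih => rw [hCrec]; exact (hD1cont _).comp ih (hCmaps k ω)
  have hTsymm : ∀ t, Measurable[F t, F (t + 1)] T.symm := by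
    rintro t _ hs
    rw [hFshift] at hs
    obtain ⟨S, hS, rfl⟩ := hs
    simpa [← Set.preimage_comp] using hS
  have hTsymm_iter : ∀ m : ℕ, Measurable[F 0, F m] (⇑T.symm)^[m] := by
    intro m
    induction m with
    | zero => exact measurable_id
    | succ m ih =>
      rw [Function.iterate_succ', Nat.cast_succ]
      exact (hTsymm m).comp ih
  have hKm : ∀ (m : ℕ) x, MeasurableSet[F 0] {ω | x ∈ K ((⇑T.symm)^[m] ω)} := by
    intro m x
    have h0 : MeasurableSet[F 0] {ω | x ∈ K ω} := by
      let _ : MeasurableSpace Ω := F 0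
      exact (measurable_id.prodMk measurable_const) hKgraph
    exact hTsymm_iter m (hFmono (Int.natCast_nonneg m) _ h0)
  have hDm : @Measurable (Ω × EuclideanSpace ℝ (Fin n)) _ ((F 1).prod inferInstance) inferInstance
      (fun p => if p.2 ∈ K p.1 then D p.1 p.2 else 0) := by
    have h1 : Measurable (Sum.elim id fun _ => 0 :
        EuclideanSpace ℝ (Fin n) ⊕ Unit → EuclideanSpace ℝ (Fin n)) :=
      measurable_fun_sum measurable_id measurable_const
    convert h1.comp hD1meas using 1
    ext p : 1
    by_cases hp : p.2 ∈ K p.1 <;> simp [hp]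
  have hCm : ∀ m k, k ≤ m → ∀ x, ∃ g : Ω → EuclideanSpace ℝ (Fin n), Measurable[F 0] g ∧
      ∀ ω, x ∈ K ((⇑T.symm)^[m] ω) → C k ((⇑T.symm)^[m] ω) x = g ω := by
    intro m k hk x
    induction k with
    | zero => exact ⟨fun _ => x, measurable_const, fun ω _ => by simp [hC0]⟩
    | succ k ih =>
      obtain ⟨g, hg, hgeq⟩ := ih (by omega)
      obtain ⟨r, rfl⟩ : ∃ r, m = k + (r + 1) := ⟨m - k - 1, by omega⟩
      have hit : ∀ ω, (⇑T)^[k] ((⇑T.symm)^[k + (r + 1)] ω) = (⇑T.symm)^[r + 1] ω := fun ω => by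
        rw [Function.iterate_add_apply, hinv]
      have hr : Measurable[F 0, F 1] (⇑T.symm)^[r + 1] :=
        (hTsymm_iter (r + 1)).mono le_rfl (hFmono (by push_cast; omega))
      have hpair : @Measurable Ω (Ω × EuclideanSpace ℝ (Fin n)) (F 0)
          ((F 1).prod inferInstance) (fun ω => ((⇑T.symm)^[r + 1] ω, g ω)) :=
        Measurable.prodMk hr hg
      refine ⟨fun ω => if g ω ∈ K ((⇑T.symm)^[r + 1] ω) then D ((⇑T.symm)^[r + 1] ω) (g ω) else 0,
        hDm.comp hpair, fun ω hx => ?_⟩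
      have hmem := hCmaps k _ hx
      rw [hit, hgeq ω hx] at hmem
      rw [hCrec, hit, Function.comp_apply, hgeq ω hx]
      exact (if_pos hmem).symm
  have hmeas : ∀ m : ℕ, MeasurableSet[F 0] {ω | ConeStrictlyMonotoneOn (K ((⇑T.symm)^[m] ω)) (K ω)
      (C m ((⇑T.symm)^[m] ω))} := by
    intro m
    choose g hg hgeq using hCm m m le_rfl
    exact @measurableSet_coneStrictlyMonotoneOn _ _ (F 0) _ _ _ _ _ _ _ (fun ω => hKsolid _)
      (fun ω => (hKsolid ω).2.1) _ (fun ω x => g x ω) (fun ω => hCcont _ _) (hKm m) (hKm 0) hg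
      (fun ω x hx => hgeq x ω hx)
  have hCsucc : ∀ m ω, C (m + 1) ω = C m (T ω) ∘ D ω := by
    intro m ω
    induction m with
    | zero => rw [hCrec, hC0, hC0]; rfl
    | succ m ih => rw [hCrec, ih, hCrec m (T ω), ← Function.iterate_succ_apply]; rfl
  refine ⟨_, hmeas, ?_, ?_, fun m _ ω hω => hω⟩
  · refine monotone_nat_of_le_succ fun m ω hω x hx y hy hxy => ?_
    have hT' : T ((⇑T.symm)^[m + 1] ω) = (⇑T.symm)^[m] ω := by
      rw [Function.iterate_succ_apply', T.apply_symm_apply]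
    have hmaps := hDmaps ((⇑T.symm)^[m + 1] ω)
    have hmono := (hD3 ((⇑T.symm)^[m + 1] ω)).2.1 x hx y hy hxy
    rw [hT'] at hmaps hmono
    rw [hCsucc, hT']
    exact hω _ (hmaps x hx) _ (hmaps y hy) hmono
  · set A : ℕ → Set Ω := fun m => {ω | ConeStrictlyMonotoneOn (K ω) (K ((⇑T)^[m] ω)) (C m ω)}
      with hA
    have hAmono : Monotone A := by
      refine monotone_nat_of_le_succ fun m ω hω x hx y hy hxy => ?_
      rw [hCrec, Function.iterate_succ_apply']
      exact (hD3 _).2.2 _ (hCmaps m ω hx) _ (hCmaps m ω hy) (hω x hx y hy hxy)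
    have hAP : ∀ m, P (A m) = P {ω | ConeStrictlyMonotoneOn (K ((⇑T.symm)^[m] ω)) (K ω)
        (C m ((⇑T.symm)^[m] ω))} := by
      intro m
      rw [← (hTP.iterate m).measure_preimage (hFle 0 _ (hmeas m)).nullMeasurableSet]
      simp only [hA, Set.preimage_ofPred_eq, hinv']
    have hlim := tendsto_measure_iUnion_atTop (μ := P) hAmono
    have hone : P (⋃ m, A m) = 1 := by
      rw [← measure_univ (μ := P)]
      refine measure_congr (eventuallyEq_univ.2 ?_)
      filter_upwards [hCstrict] with ω hω
      obtain ⟨l, -, hl⟩ := hω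
      exact Set.mem_iUnion.2 ⟨l, hl⟩
    simpa only [hAP, hone, Function.comp_def] using hlim
end
end

section
/- Let ω ↦ K(ω) be an ℱ-measurable set-valued mapping where each K(ω) is a solid cone in V (measurability meaning the graph {(ω,x) : x ∈ K(ω)} belongs to ℱ × 𝒱, which for closed-valued mappings over a complete probability space is equivalent to the standard set-valued measurability). Then the dual-cone mapping ω ↦ K*(ω) is ℱ-measurable: the graph {(ω, φ) ∈ Ω × V* : φ ∈ K*(ω)} belongs to ℱ × 𝒱*, where 𝒱* is the Borel σ-algebra on V*. -/
open MeasureTheory Filter Topology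
open scoped ENNReal Classical

noncomputable section

theorem IsCone.convex {E : Type*} [AddCommGroup E] [Module ℝ E] {K : Set E} (hK : IsCone K) :
    Convex ℝ K :=
  fun x hx y hy a b ha hb _ => hK x hx y hy a b ha hb

/-- A functional is in the dual of a solid cone as soon as it is nonnegative on the points
of the cone that lie in a given dense set. -/
theorem IsSolidCone.mem_dualCone_iff_of_dense {E : Type*} [NormedAddCommGroup E]
    [NormedSpace ℝ E] {K D : Set E} (hK : IsSolidCone K) (hD : Dense D) (φ : E →L[ℝ] ℝ) :
    φ ∈ dualCone K ↔ ∀ d ∈ D, d ∈ K → 0 ≤ φ d := by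
  obtain ⟨hcone, -, -, hint⟩ := hK
  refine ⟨fun h d _ hd => h d hd, fun h x hx => ?_⟩
  by_contra! hneg
  have hopen : IsOpen {y | φ y < 0} := isOpen_lt φ.continuous continuous_const
  have hx' : x ∈ closure (interior K) := by
    rw [hcone.convex.closure_interior_eq_closure_of_nonempty_interior hint]
    exact subset_closure hx
  have hne : ({y | φ y < 0} ∩ interior K).Nonempty := mem_closure_iff.1 hx' _ hopen hneg
  obtain ⟨d, ⟨hdneg, hdK⟩, hdD⟩ := hD.inter_open_nonempty _ (hopen.inter isOpen_interior) hne
  exact (h d hdD (interior_subset hdK)).not_gt hdneg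

/-- **Proposition A.3(i).** If `ω ↦ K(ω)` is an `ℱ`-measurable family of solid cones
(graph in `ℱ × 𝒱`), then the dual-cone mapping `ω ↦ K*(ω)` is `ℱ`-measurable: its graph
belongs to `ℱ × 𝒱*`. -/
theorem measurable_dualCone_graph
    {E : Type*} [NormedAddCommGroup E] [NormedSpace ℝ E] [FiniteDimensional ℝ E]
    [MeasurableSpace E] [BorelSpace E]
    [MeasurableSpace (E →L[ℝ] ℝ)] [BorelSpace (E →L[ℝ] ℝ)]
    {Ω : Type*} [MeasurableSpace Ω]
    (P : Measure Ω) [IsProbabilityMeasure P] (hPcomplete : P.IsComplete)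
    (K : Ω → Set E) (hKsolid : ∀ ω, IsSolidCone (K ω))
    (hKgraph : MeasurableSet {p : Ω × E | p.2 ∈ K p.1}) :
    MeasurableSet {p : Ω × (E →L[ℝ] ℝ) | p.2 ∈ dualCone (K p.1)} := by
  have : ProperSpace E := FiniteDimensional.proper_real E
  obtain ⟨D, hDcount, hDdense⟩ := TopologicalSpace.exists_countable_dense E
  have hgraph : {p : Ω × (E →L[ℝ] ℝ) | p.2 ∈ dualCone (K p.1)} =
      ⋂ d ∈ D, {p | d ∈ K p.1 → 0 ≤ p.2 d} := by
    ext p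
    simp [(hKsolid p.1).mem_dualCone_iff_of_dense hDdense]
  rw [hgraph]
  refine MeasurableSet.biInter hDcount fun d _ => ?_
  have hsection : MeasurableSet {ω | d ∈ K ω} := measurable_prodMk_right hKgraph
  have heval : Measurable fun φ : E →L[ℝ] ℝ => φ d :=
    (ContinuousLinearMap.apply ℝ ℝ d).continuous.measurable
  exact (measurable_fst hsection).imp
    (measurableSet_le measurable_const (heval.comp measurable_snd))
end
end

section
/- Let ω ↦ K(ω) be an ℱ-measurable set-valued mapping where each K(ω) is a solid cone in V (graph {(ω,x) : x ∈ K(ω)} ∈ ℱ × 𝒱). Then the interior of the dual cone, ω ↦ (K*(ω))°, is ℱ-measurable and nonempty-valued, and there exists an ℱ-measurable mapping φ : Ω → V* such that φ(ω) belongs to the interior of K*(ω) for every ω; every such φ(ω) is strictly positive on K(ω), i.e. ⟨φ(ω), x⟩ > 0 for all nonzero x ∈ K(ω). -/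
open MeasureTheory Filter Topology
open scoped ENNReal Classical

noncomputable section

namespace IsSolidCone

variable {E : Type*} [NormedAddCommGroup E] [NormedSpace ℝ E] {K : Set E}

theorem zero_mem (hK : IsSolidCone K) : (0 : E) ∈ K :=
  (hK.2.2.1.symm ▸ Set.mem_singleton (0 : E) : (0 : E) ∈ K ∩ (-K)).1

theorem smul_mem (hK : IsSolidCone K) {x : E} (hx : x ∈ K) {a : ℝ} (ha : 0 ≤ a) : a • x ∈ K := by
  simpa using hK.1 x hx x hx a 0 ha le_rfl

theorem convex (hK : IsSolidCone K) : Convex ℝ K :=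
  fun x hx y hy a b ha hb _ => hK.1 x hx y hy a b ha hb

/-- A solid cone is the closure of its trace on any dense set. -/
theorem subset_closure_inter_dense_s10 (hK : IsSolidCone K) {D : Set E} (hD : Dense D) :
    K ⊆ closure (K ∩ D) := by
  intro x hx
  have hx' : x ∈ closure (interior K) := by
    rw [hK.convex.closure_interior_eq_closure_of_nonempty_interior hK.2.2.2]
    exact subset_closure hx
  have hsub : closure (interior K) ⊆ closure (K ∩ D) :=
    closure_minimal ((hD.open_subset_closure_inter isOpen_interior).trans
      (closure_mono (Set.inter_subset_inter_left D interior_subset))) isClosed_closure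
  exact hsub hx'

/-- Hahn–Banach: a point outside a solid cone is separated from it by an element of the dual. -/
theorem exists_dual_neg (hK : IsSolidCone K) {x : E} (hx : x ∉ K) :
    ∃ f ∈ dualCone K, f x < 0 := by
  obtain ⟨f, u, hfx, hf⟩ := geometric_hahn_banach_point_closed hK.convex hK.2.1 hx
  have hu : u < 0 := by simpa using hf 0 hK.zero_mem
  refine ⟨f, fun b hb => ?_, hfx.trans hu⟩
  by_contra! hneg
  have h := hf _ (hK.smul_mem hb (div_pos_of_neg_of_neg hu hneg).le)
  rw [map_smul, smul_eq_mul, div_mul_cancel₀ u hneg.ne] at h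
  exact lt_irrefl u h

theorem exists_dual_gt_one (hK : IsSolidCone K) {x : E} (hx : x ∈ K) (hx0 : x ≠ 0) :
    ∃ f ∈ dualCone K, 1 < f x := by
  have hnx : -x ∉ K := fun h => hx0 (by
    have : x ∈ K ∩ (-K) := ⟨hx, h⟩
    rwa [hK.2.2.1] at this)
  obtain ⟨f, hf, hfx⟩ := hK.exists_dual_neg hnx
  have hpos : 0 < f x := by simpa using hfx
  refine ⟨(2 / f x) • f, fun y hy => mul_nonneg (by positivity) (hf y hy), ?_⟩
  simp [div_mul_cancel₀ (2 : ℝ) hpos.ne']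

theorem exists_dual_ge_norm [FiniteDimensional ℝ E] (hK : IsSolidCone K) :
    ∃ f : E →L[ℝ] ℝ, ∀ x ∈ K, ‖x‖ ≤ f x := by
  have : ProperSpace E := FiniteDimensional.proper_real E
  have hS : IsCompact (K ∩ Metric.sphere (0 : E) 1) := (isCompact_sphere 0 1).inter_left hK.2.1
  obtain ⟨f, -, hf⟩ : ∃ f ∈ dualCone K, ∀ x ∈ K ∩ Metric.sphere (0 : E) 1, x ∈ K → 1 ≤ f x := by
    refine hS.induction_on (p := fun s => ∃ f ∈ dualCone K, ∀ x ∈ s, x ∈ K → 1 ≤ f x)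
      ⟨0, fun _ _ => le_rfl, by simp⟩ ?_ ?_ ?_
    · rintro s t hst ⟨f, hfK, hf⟩
      exact ⟨f, hfK, fun x hx => hf x (hst hx)⟩
    · rintro s t ⟨f, hfK, hf⟩ ⟨g, hgK, hg⟩
      refine ⟨f + g, fun x hx => add_nonneg (hfK x hx) (hgK x hx), fun x hx hxK => ?_⟩
      rcases hx with hx | hx
      · exact le_add_of_le_of_nonneg (hf x hx hxK) (hgK x hxK)
      · exact le_add_of_nonneg_of_le (hfK x hxK) (hg x hx hxK)
    · rintro x ⟨hxK, hx⟩
      obtain ⟨f, hfK, hfx⟩ := hK.exists_dual_gt_one hxK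
        (ne_zero_of_mem_unit_sphere (⟨x, hx⟩ : Metric.sphere (0 : E) 1))
      exact ⟨{y | 1 < f y}, mem_nhdsWithin_of_mem_nhds
        ((isOpen_lt continuous_const f.continuous).mem_nhds hfx), f, hfK,
        fun y hy _ => (show 1 < f y from hy).le⟩
  refine ⟨f, fun x hx => ?_⟩
  rcases eq_or_ne x 0 with rfl | hx0
  · simp
  have hn : 0 < ‖x‖ := norm_pos_iff.2 hx0
  have hxS : ‖x‖⁻¹ • x ∈ K := hK.smul_mem hx (by positivity)
  have h := hf _ ⟨hxS, by simp [norm_smul, hn.ne']⟩ hxS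
  rw [map_smul, smul_eq_mul, inv_mul_eq_div, one_le_div hn] at h
  exact h

end IsSolidCone

section DualCone

variable {E : Type*} [NormedAddCommGroup E] [NormedSpace ℝ E] {K : Set E}

/-- The interior of the dual cone consists of the functionals bounded below on the cone by a
positive multiple of the norm. -/
theorem mem_interior_dualCone_iff {ψ : E →L[ℝ] ℝ} :
    ψ ∈ interior (dualCone K) ↔ ∃ n : ℕ, ∀ x ∈ K, 1 / ((n : ℝ) + 1) * ‖x‖ ≤ ψ x := by
  rw [mem_interior_iff_mem_nhds]
  constructor
  · intro h
    obtain ⟨ε, hε, hball⟩ := Metric.mem_nhds_iff.1 h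
    obtain ⟨n, hn⟩ := exists_nat_one_div_lt hε
    refine ⟨n, fun x hx => ?_⟩
    obtain ⟨g, hg, hgx⟩ := exists_dual_vector'' ℝ x
    have hpos : 0 < 1 / ((n : ℝ) + 1) := Nat.one_div_pos_of_nat
    have hmem : ψ - (1 / ((n : ℝ) + 1)) • g ∈ dualCone K := by
      apply hball
      rw [mem_ball_iff_norm, sub_sub_cancel_left, norm_neg, norm_smul, Real.norm_of_nonneg hpos.le]
      exact (mul_le_of_le_one_right hpos.le hg).trans_lt hn
    have h0 : 0 ≤ ψ x - 1 / ((n : ℝ) + 1) * g x := hmem x hx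
    rw [hgx] at h0
    exact sub_nonneg.1 h0
  · rintro ⟨n, hn⟩
    refine Metric.mem_nhds_iff.2 ⟨1 / ((n : ℝ) + 1), Nat.one_div_pos_of_nat, fun χ hχ x hx => ?_⟩
    have h1 : ‖(χ - ψ) x‖ ≤ 1 / ((n : ℝ) + 1) * ‖x‖ :=
      (χ - ψ).le_of_opNorm_le (mem_ball_iff_norm.1 hχ).le x
    have h2 := (abs_le.1 h1).1
    have h3 := hn x hx
    rw [sub_apply] at h2
    linarith

theorem mem_interior_dualCone_iff_of_dense (hK : IsSolidCone K) {D : Set E} (hD : Dense D)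
    {ψ : E →L[ℝ] ℝ} :
    ψ ∈ interior (dualCone K) ↔
      ∃ n : ℕ, ∀ x ∈ D, x ∈ K → 1 / ((n : ℝ) + 1) * ‖x‖ ≤ ψ x := by
  rw [mem_interior_dualCone_iff]
  refine exists_congr fun n => ⟨fun h x _ hx => h x hx, fun h x hx => ?_⟩
  have hclosed : IsClosed {x : E | 1 / ((n : ℝ) + 1) * ‖x‖ ≤ ψ x} :=
    isClosed_le (by fun_prop) ψ.continuous
  exact closure_minimal (fun y hy => h y hy.2 hy.1) hclosed (hK.subset_closure_inter_dense_s10 hD hx)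

theorem IsSolidCone.interior_dualCone_nonempty [FiniteDimensional ℝ E] (hK : IsSolidCone K) :
    (interior (dualCone K)).Nonempty := by
  obtain ⟨f, hf⟩ := hK.exists_dual_ge_norm
  exact ⟨f, mem_interior_dualCone_iff.2 ⟨0, by simpa using hf⟩⟩

theorem pos_of_mem_interior_dualCone {ψ : E →L[ℝ] ℝ} (hψ : ψ ∈ interior (dualCone K))
    {x : E} (hx : x ∈ K) (hx0 : x ≠ 0) : 0 < ψ x := by
  obtain ⟨n, hn⟩ := mem_interior_dualCone_iff.1 hψ
  exact (mul_pos Nat.one_div_pos_of_nat (norm_pos_iff.2 hx0)).trans_le (hn x hx)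

theorem measurableSet_graph_interior_dualCone [SecondCountableTopology E] [MeasurableSpace E]
    [MeasurableSpace (E →L[ℝ] ℝ)] [BorelSpace (E →L[ℝ] ℝ)]
    {Ω : Type*} [MeasurableSpace Ω] {K : Ω → Set E} (hK : ∀ ω, IsSolidCone (K ω))
    (hgraph : MeasurableSet {p : Ω × E | p.2 ∈ K p.1}) :
    MeasurableSet {p : Ω × (E →L[ℝ] ℝ) | p.2 ∈ interior (dualCone (K p.1))} := by
  obtain ⟨D, hDc, hD⟩ := TopologicalSpace.exists_countable_dense E
  simp only [fun p : Ω × (E →L[ℝ] ℝ) =>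
    mem_interior_dualCone_iff_of_dense (hK p.1) hD (ψ := p.2), Set.ofPred_exists]
  refine MeasurableSet.iUnion fun n => ?_
  simp only [Set.ofPred_forall]
  refine MeasurableSet.biInter hDc fun x _ => ?_
  have hx : MeasurableSet {ω | x ∈ K ω} := measurable_prodMk_right hgraph
  have hclosed : IsClosed {ψ : E →L[ℝ] ℝ | 1 / ((n : ℝ) + 1) * ‖x‖ ≤ ψ x} :=
    isClosed_le continuous_const (by fun_prop)
  exact (measurable_fst hx).imp (measurable_snd hclosed.measurableSet)

end DualCone

/-- A measurable family of nonempty open sets in a separable space has a measurable selection. -/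
theorem exists_measurable_selection_of_isOpen {Ω X : Type*} [MeasurableSpace Ω]
    [TopologicalSpace X] [TopologicalSpace.SeparableSpace X] [MeasurableSpace X] {U : Ω → Set X}
    (hopen : ∀ ω, IsOpen (U ω)) (hne : ∀ ω, (U ω).Nonempty)
    (hgraph : MeasurableSet {p : Ω × X | p.2 ∈ U p.1}) :
    ∃ φ : Ω → X, Measurable φ ∧ ∀ ω, φ ω ∈ U ω := by
  rcases isEmpty_or_nonempty Ω with _ | ⟨⟨ω₀⟩⟩
  · exact ⟨isEmptyElim, measurable_of_empty _, isEmptyElim⟩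
  have : Nonempty X := ⟨(hne ω₀).some⟩
  have hex : ∀ ω, ∃ n, TopologicalSpace.denseSeq X n ∈ U ω := fun ω =>
    (TopologicalSpace.denseRange_denseSeq X).exists_mem_open (hopen ω) (hne ω)
  exact ⟨fun ω => TopologicalSpace.denseSeq X (Nat.find (hex ω)),
    measurable_from_nat.comp (measurable_find hex fun _ => measurable_prodMk_right hgraph),
    fun ω => Nat.find_spec (hex ω)⟩


/-- **Propositions A.1 and A.3 combined.** If `ω ↦ K(ω)` is an `ℱ`-measurable family of
solid cones, then `ω ↦ (K*(ω))°` is `ℱ`-measurable and nonempty-valued, there is an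
`ℱ`-measurable selection `φ(ω) ∈ (K*(ω))°`, and every functional in `(K*(ω))°` is
strictly positive on `K(ω) ∖ {0}`. -/
theorem exists_measurable_interior_dual_selection
    {E : Type*} [NormedAddCommGroup E] [NormedSpace ℝ E] [FiniteDimensional ℝ E]
    [MeasurableSpace E] [BorelSpace E]
    [MeasurableSpace (E →L[ℝ] ℝ)] [BorelSpace (E →L[ℝ] ℝ)]
    {Ω : Type*} [MeasurableSpace Ω]
    (P : Measure Ω) [IsProbabilityMeasure P] (hPcomplete : P.IsComplete)
    (K : Ω → Set E) (hKsolid : ∀ ω, IsSolidCone (K ω))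
    (hKgraph : MeasurableSet {p : Ω × E | p.2 ∈ K p.1}) :
    (∀ ω, (interior (dualCone (K ω))).Nonempty) ∧
    MeasurableSet {p : Ω × (E →L[ℝ] ℝ) | p.2 ∈ interior (dualCone (K p.1))} ∧
    (∃ φ : Ω → (E →L[ℝ] ℝ), Measurable φ ∧ ∀ ω, φ ω ∈ interior (dualCone (K ω))) ∧
    (∀ ω, ∀ ψ ∈ interior (dualCone (K ω)), ∀ x ∈ K ω, x ≠ 0 → 0 < ψ x) := by
  have : ProperSpace E := FiniteDimensional.proper_real E
  have : ProperSpace (E →L[ℝ] ℝ) := FiniteDimensional.proper_real _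
  have hne : ∀ ω, (interior (dualCone (K ω))).Nonempty := fun ω =>
    (hKsolid ω).interior_dualCone_nonempty
  have hmeas := measurableSet_graph_interior_dualCone hKsolid hKgraph
  exact ⟨hne, hmeas, exists_measurable_selection_of_isOpen (fun _ => isOpen_interior) hne hmeas,
    fun _ _ hψ _ hx hx0 => pos_of_mem_interior_dualCone hψ hx hx0⟩
end
end

section
/- Let K and L be solid cones in V and D : K → L a monotone mapping homogeneous of degree 1 (D(λx) = λD(x) for λ > 0). If there exists h* ∈ K with D(h*) ∈ L°, then D(h) ∈ L° for every h ∈ K°; that is, for monotone homogeneous maps, condition (M4) implies condition (M2). -/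
open MeasureTheory Filter Topology
open scoped ENNReal Classical

noncomputable section

/-- The interior of a cone is stable under positive scaling followed by translation by an
element of the cone. -/
theorem IsCone.smul_add_mem_interior {E : Type*} [NormedAddCommGroup E] [NormedSpace ℝ E]
    {L : Set E} (hL : IsCone L) {x y : E} {c : ℝ} (hc : 0 < c) (hx : x ∈ interior L)
    (hy : y ∈ L) : c • x + y ∈ interior L := by
  have hcont : Continuous fun z : E => c⁻¹ • (z - y) := by fun_prop
  refine mem_interior.2 ⟨_, ?_, (isOpen_interior (s := L)).preimage hcont, ?_⟩
  · intro z hz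
    have hmem := hL _ (interior_subset hz) y hy c 1 hc.le zero_le_one
    simpa [smul_inv_smul₀ hc.ne'] using hmem
  · simpa [inv_smul_smul₀ hc.ne'] using hx

/-- A small positive multiple of any vector can be subtracted from an interior point of a set
without leaving the set. -/
theorem exists_pos_sub_smul_mem_of_mem_interior {E : Type*} [NormedAddCommGroup E]
    [NormedSpace ℝ E] {K : Set E} {x : E} (hx : x ∈ interior K) (v : E) :
    ∃ c : ℝ, 0 < c ∧ x - c • v ∈ K := by
  have hcont : ContinuousAt (fun c : ℝ => x - c • v) 0 := by fun_prop
  have hev : ∀ᶠ c : ℝ in 𝓝 0, x - c • v ∈ K :=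
    hcont.eventually_mem (by simpa using mem_interior_iff_mem_nhds.1 hx)
  obtain ⟨c, hmem, hpos⟩ :=
    ((hev.filter_mono nhdsWithin_le_nhds).and (self_mem_nhdsWithin (s := Set.Ioi (0 : ℝ)))).exists
  exact ⟨c, hpos, hmem⟩

/-- **(M4) implies (M2) for monotone homogeneous maps.** If `D : K → L` is monotone and
homogeneous of degree one and `D h* ∈ L°` for some `h* ∈ K`, then `D h ∈ L°` for every
`h ∈ K°`. -/
theorem monotone_homogeneous_M4_implies_M2
    {E : Type*} [NormedAddCommGroup E] [NormedSpace ℝ E] [FiniteDimensional ℝ E]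
    (K L : Set E) (hK : IsSolidCone K) (hL : IsSolidCone L)
    (D : E → E) (hDmaps : ∀ x ∈ K, D x ∈ L)
    (hDmono : ∀ x ∈ K, ∀ y ∈ K, coneLE K x y → coneLE L (D x) (D y))
    (hDhom : ∀ l : ℝ, 0 < l → ∀ x ∈ K, D (l • x) = l • D x)
    (hM4 : ∃ h ∈ K, D h ∈ interior L) :
    ∀ h ∈ interior K, D h ∈ interior L := by
  intro h hh
  obtain ⟨v, hv, hDv⟩ := hM4
  obtain ⟨c, hc, hsub⟩ := exists_pos_sub_smul_mem_of_mem_interior hh v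
  have hcv : c • v ∈ K := by simpa using hK.1 v hv v hv c 0 hc.le le_rfl
  have hle : D h - D (c • v) ∈ L := hDmono _ hcv h (interior_subset hh) hsub
  rw [hDhom c hc v hv] at hle
  simpa using hL.1.smul_add_mem_interior hc hDv hle
end
end
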